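/- arXiv:2403.12513 — 2 statements merged into one kernel-verified Lean document; each statement's English description precedes it below -/
import Mathlib

section
/- Let 1<p<∞, 1<q≤∞, 0<β<1 and Λ≥41. Assume the doubling measure μ also satisfies the reverse doubling condition with some constant 0<c_R<1 and the quantitative reverse doubling condition with some exponent σ>βp. Let B=B(x,r)⊂X be a ball with x∈X and 0<r<(1/80)diam(X), and let E⊂closure(B) be a compact set. Then there is a constant C≥1, independent of B and E (depending only on p, q, β, σ, Λ, c_μ, c_R, c_σ), such that C^{-1}·Cp^β_{p,q}(E) ≤ cap^β_{p,q}(E,2B,ΛB) ≤ C·Cp^β_{p,q}(E). -/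
open MeasureTheory Metric Set
open scoped ENNReal NNReal

noncomputable section

namespace TLCap

variable {X : Type*} [MetricSpace X] [MeasurableSpace X] [BorelSpace X]

/-- `validIdx X n` means `n ≥ n₀`, i.e. `2^{-n} ≤ 2 diam X`;
all `n : ℤ` are valid when `X` is unbounded. -/
def validIdx (X : Type*) [PseudoMetricSpace X] (n : ℤ) : Prop :=
  ENNReal.ofReal ((2 : ℝ) ^ (-n)) ≤ 2 * EMetric.diam (Set.univ : Set X)

/-- The doubling condition for `μ`, with doubling constant `c`. -/
def IsDoubling (μ : Measure X) (c : ℝ≥0∞) : Prop :=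
  ∀ (x : X) (r : ℝ), 0 < r → μ (ball x (2 * r)) ≤ c * μ (ball x r)

/-- The reverse doubling condition with constant `c`. -/
def IsReverseDoubling (μ : Measure X) (c : ℝ≥0∞) : Prop :=
  ∀ (x : X) (r : ℝ), 0 < r → 2 * ENNReal.ofReal r < EMetric.diam (Set.univ : Set X) →
    μ (ball x (r / 2)) ≤ c * μ (ball x r)

/-- The quantitative reverse doubling condition with exponent `σ` and constant `c`. -/
def IsQRD (μ : Measure X) (σ : ℝ) (c : ℝ≥0∞) : Prop :=
  ∀ (x : X) (r R : ℝ), 0 < r → r < R →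
    ENNReal.ofReal R ≤ 2 * EMetric.diam (Set.univ : Set X) →
    μ (ball x r) ≤ c * ENNReal.ofReal ((r / R) ^ σ) * μ (ball x R)

open Classical in
/-- The `l^q` norm of a sequence of extended nonnegative reals (`q = ∞` allowed). -/
def lqNorm (q : ℝ≥0∞) (a : ℤ → ℝ≥0∞) : ℝ≥0∞ :=
  if q = ∞ then ⨆ k, a k else (∑' k, a k ^ q.toReal) ^ (1 / q.toReal)

/-- The mixed norm `‖g‖_{L^p(Ω; l^q)}`. -/
def mixedNorm (μ : Measure X) (Ω : Set X) (p : ℝ) (q : ℝ≥0∞) (g : ℤ → X → ℝ≥0∞) : ℝ≥0∞ :=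
  (∫⁻ x in Ω, lqNorm q (fun k => g k x) ^ p ∂μ) ^ (1 / p)

/-- `g = (g_k)_{k ∈ ℤ}` is a fractional `β`-Hajłasz gradient of `u` on `Ω`. -/
def IsFracGrad (μ : Measure X) (β : ℝ) (Ω : Set X) (u : X → ℝ) (g : ℤ → X → ℝ≥0∞) : Prop :=
  (∀ k, Measurable (g k)) ∧
  ∃ N : Set X, N ⊆ Ω ∧ μ N = 0 ∧
    ∀ (k : ℤ), ∀ x ∈ Ω \ N, ∀ y ∈ Ω \ N,
      (2 : ℝ) ^ (-k - 1) ≤ dist x y → dist x y < (2 : ℝ) ^ (-k) →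
      ENNReal.ofReal |u x - u y| ≤ ENNReal.ofReal (dist x y ^ β) * (g k x + g k y)

/-- The homogeneous Hajłasz–Triebel–Lizorkin seminorm `|u|_{Ṁ^β_{p,q}(Ω)}`. -/
def htlSeminorm (μ : Measure X) (β p : ℝ) (q : ℝ≥0∞) (Ω : Set X) (u : X → ℝ) : ℝ≥0∞ :=
  ⨅ g : {g : ℤ → X → ℝ≥0∞ // IsFracGrad μ β Ω u g}, mixedNorm μ Ω p q g.1

/-- The relative Hajłasz–Triebel–Lizorkin capacity `cap^β_{p,q}(E, 2B, ΛB)`,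
where `B = B(x₀, r)`. -/
def relCap (μ : Measure X) (β p : ℝ) (q : ℝ≥0∞) (E : Set X) (x₀ : X) (r Λ : ℝ) : ℝ≥0∞ :=
  ⨅ φ : {φ : X → ℝ // Continuous φ ∧ (∀ x ∈ E, 1 ≤ φ x) ∧ ∀ x ∉ ball x₀ (2 * r), φ x = 0},
    htlSeminorm μ β p q (ball x₀ (Λ * r)) φ.1 ^ p

open Classical in
/-- The potential `H_β f`. -/
def Hpot (μ : Measure X) (β : ℝ) (f : ℤ → X → ℝ≥0∞) (x : X) : ℝ≥0∞ :=
  ∑' n : ℤ, if validIdx X n then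
    (2 : ℝ≥0∞) ^ (-β * (n : ℝ)) *
      ∫⁻ y, (ball y ((2 : ℝ) ^ (-n))).indicator (fun _ => (1 : ℝ≥0∞)) x * f n y /
        μ (ball y ((2 : ℝ) ^ (-n))) ∂μ
  else 0

/-- A sequence `(f_n)_{n ≥ n₀}` of nonnegative Borel functions, realized as a sequence
indexed by `ℤ` vanishing at invalid indices. -/
def IsAdmissibleSeq (f : ℤ → X → ℝ≥0∞) : Prop :=
  (∀ n, Measurable (f n)) ∧ ∀ n, ¬ validIdx X n → f n = 0

/-- The Triebel–Lizorkin `(β,p,q)`-capacity `Cp^β_{p,q}(E)`. -/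
def CpCap (μ : Measure X) (β p : ℝ) (q : ℝ≥0∞) (E : Set X) : ℝ≥0∞ :=
  ⨅ f : {f : ℤ → X → ℝ≥0∞ // IsAdmissibleSeq f ∧ ∀ x ∈ E, 1 ≤ Hpot μ β f x},
    mixedNorm μ Set.univ p q f.1 ^ p

open Classical in
/-- The sequence `Ȟ_β ν`. -/
def Hcheck (μ ν : Measure X) (β : ℝ) : ℤ → X → ℝ≥0∞ := fun n x =>
  if validIdx X n then
    (2 : ℝ≥0∞) ^ (-β * (n : ℝ)) * ν (ball x ((2 : ℝ) ^ (-n))) / μ (ball x ((2 : ℝ) ^ (-n)))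
  else 0

/-- `ν` is a nonnegative Radon measure on the (compact) set `E`. -/
def IsRadonOn (ν : Measure X) (E : Set X) : Prop :=
  ν Eᶜ = 0 ∧ ν E ≠ ∞ ∧
  (∀ F : Set X, MeasurableSet F → F ⊆ E →
    ν F = ⨅ (U : Set X) (_ : IsOpen U) (_ : F ⊆ U ∩ E), ν (U ∩ E)) ∧
  (∀ F : Set X, MeasurableSet F → F ⊆ E →
    ν F = ⨆ (K : Set X) (_ : IsCompact K) (_ : K ⊆ F), ν K)

open Classical in
/-- The conjugate exponent, with `1' = ∞` and `∞' = 1`. -/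
def conjExp (q : ℝ≥0∞) : ℝ≥0∞ :=
  if q = 1 then ∞ else if q = ∞ then 1 else ENNReal.ofReal (q.toReal / (q.toReal - 1))

/-- `2^{-n₀}` (equal to `∞` when `X` is unbounded). -/
def radMax (X : Type*) [PseudoMetricSpace X] : ℝ≥0∞ :=
  ⨆ (n : ℤ) (_ : validIdx X n), ENNReal.ofReal ((2 : ℝ) ^ (-n))

/-- The fractional maximal function `M_β ν`. -/
def fracMax (μ ν : Measure X) (β : ℝ) (x : X) : ℝ≥0∞ :=
  ⨆ (r : ℝ) (_ : 0 < r) (_ : ENNReal.ofReal r ≤ radMax X),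
    ENNReal.ofReal (r ^ β) * ν (ball x r) / μ (ball x r)

/-- The Riesz potential `I_β ν` of a nonnegative Borel measure. -/
def rieszPot (μ ν : Measure X) (β : ℝ) (x : X) : ℝ≥0∞ :=
  ∫⁻ y in {x}ᶜ, ENNReal.ofReal (dist x y ^ β) / μ (ball x (dist x y)) ∂ν

/-- The Riesz `(β,p)`-capacity `R_{β,p}(E)`. -/
def rieszCap (μ : Measure X) (β p : ℝ) (E : Set X) : ℝ≥0∞ :=
  ⨅ f : {f : X → ℝ≥0∞ // Measurable f ∧ ∀ x ∈ E, 1 ≤ rieszPot μ (μ.withDensity f) β x},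
    ∫⁻ x, f.1 x ^ p ∂μ

/-- The `ρ`-restricted Hausdorff content of codimension `d`. -/
def hContent (μ : Measure X) (d : ℝ) (ρ : ℝ≥0∞) (F : Set X) : ℝ≥0∞ :=
  ⨅ c : {c : ℕ → X × ℝ //
      (∀ k, 0 < (c k).2 ∧ ENNReal.ofReal (c k).2 ≤ ρ) ∧ F ⊆ ⋃ k, ball (c k).1 (c k).2},
    ∑' k, μ (ball (c.1 k).1 (c.1 k).2) * ENNReal.ofReal ((c.1 k).2 ^ (-d))

/-- Partition of unity data at every valid scale: the balls `B(x_{n,i}, 2^{-n-1})` are pairwise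
disjoint, the balls `B(x_{n,i}, 2^{-n})` cover `X`, and `ψ_{n,i}` is the associated
partition of unity with constants `κ` and `L`. -/
def IsPartition {ι : ℤ → Type*} (pt : ∀ n, ι n → X)
    (ψ : ∀ n, ι n → X → ℝ) (κ L : ℝ) : Prop :=
  ∀ n : ℤ, validIdx X n →
    (∀ i j : ι n, i ≠ j →
        Disjoint (ball (pt n i) ((2:ℝ) ^ (-n - 1))) (ball (pt n j) ((2:ℝ) ^ (-n - 1)))) ∧
    (∀ x : X, ∃ i : ι n, x ∈ ball (pt n i) ((2:ℝ) ^ (-n))) ∧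
    (∀ (i : ι n) (x : X), 0 ≤ ψ n i x ∧ ψ n i x ≤ 1) ∧
    (∀ (i : ι n), ∀ x ∉ ball (pt n i) (6 * (2:ℝ) ^ (-n)), ψ n i x = 0) ∧
    (∀ (i : ι n), ∀ x ∈ ball (pt n i) (3 * (2:ℝ) ^ (-n)), κ ≤ ψ n i x) ∧
    (∀ i : ι n, LipschitzWith (Real.toNNReal ((2:ℝ) ^ n * L)) (ψ n i)) ∧
    (∀ x : X, HasSum (fun i : ι n => ψ n i x) 1)

open Classical in
/-- The discrete potential `L_β f`. -/
def discPot {ι : ℤ → Type*} (μ : Measure X) (β : ℝ) (pt : ∀ n, ι n → X)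
    (ψ : ∀ n, ι n → X → ℝ) (f : ℤ → X → ℝ≥0∞) (x : X) : ℝ≥0∞ :=
  ∑' n : ℤ, if validIdx X n then
    (2 : ℝ≥0∞) ^ (-β * (n : ℝ)) *
      ∑' i : ι n, ENNReal.ofReal (ψ n i x) *
        ((∫⁻ y in ball (pt n i) (3 * (2:ℝ) ^ (-n)), f n y ∂μ) /
          μ (ball (pt n i) (3 * (2:ℝ) ^ (-n))))
  else 0

/-- A geodesic metric space: any two points are joined by an isometric image of an interval. -/
def IsGeodesicSpace (X : Type*) [MetricSpace X] : Prop :=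
  ∀ x y : X, ∃ γ : ℝ → X, γ 0 = x ∧ γ (dist x y) = y ∧
    ∀ s ∈ Set.Icc (0:ℝ) (dist x y), ∀ t ∈ Set.Icc (0:ℝ) (dist x y),
      dist (γ s) (γ t) = |s - t|

/-- The Hajłasz–Triebel–Lizorkin `(β,p,q)`-capacity density condition with
constants `c₀, c₁, Λ`. -/
def HTLDensity (μ : Measure X) (β p : ℝ) (q : ℝ≥0∞) (E : Set X) (c₀ c₁ Λ : ℝ) : Prop :=
  ∀ x ∈ E, ∀ r : ℝ, 0 < r → ENNReal.ofReal r < ENNReal.ofReal c₁ * EMetric.diam E →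
    ENNReal.ofReal c₀ * relCap μ β p q (closure (ball x r)) x r Λ ≤
      relCap μ β p q (E ∩ closure (ball x r)) x r Λ

/-- The Riesz `(β,p)`-capacity density condition with constant `c₀`. -/
def RieszDensity (μ : Measure X) (β p : ℝ) (E : Set X) (c₀ : ℝ) : Prop :=
  ∀ x ∈ E, ∀ r : ℝ, 0 < r → ENNReal.ofReal (8 * r) < EMetric.diam E →
    ENNReal.ofReal c₀ * rieszCap μ β p (closure (ball x r)) ≤
      rieszCap μ β p (E ∩ closure (ball x r))

/-- The Hausdorff content density condition of codimension `d` with constant `c₀`. -/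
def HausdorffDensity (μ : Measure X) (d : ℝ) (E : Set X) (c₀ : ℝ) : Prop :=
  ∀ x ∈ E, ∀ r : ℝ, 0 < r → ENNReal.ofReal r < EMetric.diam E →
    ENNReal.ofReal c₀ * hContent μ d (ENNReal.ofReal r) (closure (ball x r)) ≤
      hContent μ d (ENNReal.ofReal r) (E ∩ closure (ball x r))


set_option linter.unusedSectionVars false

/-! ### Doubling measures -/

/-- `μ` is doubling with finite constant `c ≥ 1`, and balls have positive finite measure. -/
structure DoublingMeasure (μ : Measure X) (c : ℝ≥0∞) : Prop where
  one_le : 1 ≤ c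
  ne_top : c ≠ ∞
  doubling : IsDoubling μ c
  pos : ∀ (x : X) (r : ℝ), 0 < r → 0 < μ (ball x r)
  fin : ∀ (x : X) (r : ℝ), μ (ball x r) ≠ ∞

theorem DoublingMeasure.sigmaFinite {μ : Measure X} {c : ℝ≥0∞} (h : DoublingMeasure μ c) :
    SigmaFinite μ := by
  rcases isEmpty_or_nonempty X with hX | ⟨⟨x₀⟩⟩
  · have : μ = 0 := Measure.eq_zero_of_isEmpty μ
    rw [this]; infer_instance
  · refine Measure.sigmaFinite_of_countable (S := range fun n : ℕ => ball x₀ (n : ℝ))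
      (countable_range _) ?_ ?_
    · rintro _ ⟨n, rfl⟩
      exact (h.fin x₀ n).lt_top
    · rw [sUnion_range, iUnion_ball_nat]

theorem DoublingMeasure.secondCountable {μ : Measure X} {c : ℝ≥0∞} (h : DoublingMeasure μ c) :
    SecondCountableTopology X := by
  have := h.sigmaFinite
  refine secondCountable_of_almost_dense_set fun ε hε => ?_
  obtain ⟨u, -, hu, hcov⟩ := Vitali.exists_disjoint_subfamily_covering_enlargement_closedBall
    (univ : Set X) id (fun _ => ε / 4) (ε / 4) (fun _ _ => le_rfl) 4 (by norm_num)
  refine ⟨u, ?_, fun x => ?_⟩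
  · have := Measure.countable_meas_pos_of_disjoint_iUnion (μ := μ)
      (As := fun b : u => ball (b : X) (ε / 4)) (fun _ => measurableSet_ball) ?_
    · have h2 : {i : u | 0 < μ (ball (i : X) (ε / 4))} = univ :=
        eq_univ_of_forall fun i => h.pos _ _ (by positivity)
      rw [h2] at this
      exact countable_coe_iff.mp (countable_univ_iff.mp this)
    · intro a b hab
      exact (hu a.2 b.2 (fun hh => hab (Subtype.ext hh))).mono
        ball_subset_closedBall ball_subset_closedBall
  · obtain ⟨b, hb, hsub⟩ := hcov x (mem_univ x)
    refine ⟨b, hb, ?_⟩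
    have := hsub (mem_closedBall_self (by positivity))
    rw [mem_closedBall] at this
    simp only [id] at this
    linarith

theorem DoublingMeasure.ball_pow_le {μ : Measure X} {c : ℝ≥0∞} (h : DoublingMeasure μ c)
    (x : X) {r : ℝ} (hr : 0 < r) (k : ℕ) : μ (ball x (2 ^ k * r)) ≤ c ^ k * μ (ball x r) := by
  induction k with
  | zero => simp
  | succ k ih =>
    calc μ (ball x (2 ^ (k + 1) * r)) = μ (ball x (2 * (2 ^ k * r))) := by ring_nf
      _ ≤ c * μ (ball x (2 ^ k * r)) := h.doubling _ _ (by positivity)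
      _ ≤ c * (c ^ k * μ (ball x r)) := by gcongr
      _ = c ^ (k + 1) * μ (ball x r) := by rw [pow_succ']; ring

/-- Comparison of a ball with a ball having a dilation that contains it. -/
theorem DoublingMeasure.ball_le {μ : Measure X} {c : ℝ≥0∞} (h : DoublingMeasure μ c)
    {x y : X} {r R : ℝ} (hr : 0 < r) (k : ℕ) (hk : R + dist y x ≤ 2 ^ k * r) :
    μ (ball y R) ≤ c ^ k * μ (ball x r) :=
  (measure_mono (ball_subset_ball' hk)).trans (h.ball_pow_le x hr k)

theorem DoublingMeasure.inv_ball_le {μ : Measure X} {c : ℝ≥0∞} (h : DoublingMeasure μ c)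
    {x y : X} {r R : ℝ} (hr : 0 < r) (k : ℕ) (hk : R + dist y x ≤ 2 ^ k * r) :
    (μ (ball x r))⁻¹ ≤ c ^ k * (μ (ball y R))⁻¹ := by
  have hc0 : c ^ k ≠ 0 := pow_ne_zero _ (one_pos.trans_le h.one_le).ne'
  have hct : c ^ k ≠ ∞ := ENNReal.pow_ne_top h.ne_top
  have := ENNReal.inv_le_inv.mpr (h.ball_le hr k hk)
  rw [ENNReal.mul_inv (Or.inl hc0) (Or.inl hct)] at this
  calc (μ (ball x r))⁻¹ = c ^ k * ((c ^ k)⁻¹ * (μ (ball x r))⁻¹) := by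
        rw [← mul_assoc, ENNReal.mul_inv_cancel hc0 hct, one_mul]
    _ ≤ _ := by gcongr

/-! ### Averages -/

/-- The average of `f` over the set `S`. -/
def setAvg (μ : Measure X) (S : Set X) (f : X → ℝ≥0∞) : ℝ≥0∞ := (∫⁻ y in S, f y ∂μ) / μ S

/-- The average of `f` over the ball of radius `r` around `x`. -/
def avg (μ : Measure X) (r : ℝ) (f : X → ℝ≥0∞) (x : X) : ℝ≥0∞ := setAvg μ (ball x r) f

theorem measurableSet_dist_lt [SecondCountableTopology X] (r : ℝ) :
    MeasurableSet {z : X × X | dist z.2 z.1 < r} :=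
  measurableSet_lt (measurable_snd.dist measurable_fst) measurable_const

theorem measurable_setLIntegral_ball [SecondCountableTopology X] {μ : Measure X} [SFinite μ]
    (r : ℝ) {f : X → ℝ≥0∞} (hf : Measurable f) :
    Measurable fun x => ∫⁻ y in ball x r, f y ∂μ := by
  have : (fun x => ∫⁻ y in ball x r, f y ∂μ) =
      fun x => ∫⁻ y, {z : X × X | dist z.2 z.1 < r}.indicator (fun z => f z.2) (x, y) ∂μ := by
    ext x
    rw [← lintegral_indicator measurableSet_ball]
    rfl
  rw [this]
  exact ((hf.comp measurable_snd).indicator (measurableSet_dist_lt r)).lintegral_prod_right'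

theorem measurable_measure_ball [SecondCountableTopology X] {μ : Measure X} [SFinite μ]
    (r : ℝ) : Measurable fun x => μ (ball x r) := by
  simpa using measurable_setLIntegral_ball (μ := μ) r (measurable_const (a := (1 : ℝ≥0∞)))

theorem measurable_avg [SecondCountableTopology X] {μ : Measure X} [SFinite μ]
    (r : ℝ) {f : X → ℝ≥0∞} (hf : Measurable f) : Measurable (avg μ r f) :=
  (measurable_setLIntegral_ball r hf).div (measurable_measure_ball r)

theorem setAvg_mono {μ : Measure X} {S : Set X} {f g : X → ℝ≥0∞} (h : ∀ y, f y ≤ g y) :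
    setAvg μ S f ≤ setAvg μ S g := by
  unfold setAvg
  gcongr
  exact h _

theorem setAvg_const {μ : Measure X} {S : Set X} (h0 : μ S ≠ 0) (ht : μ S ≠ ∞) (a : ℝ≥0∞) :
    setAvg μ S (fun _ => a) = a := by
  simp [setAvg, ENNReal.mul_div_cancel_right h0 ht]

theorem setAvg_const_add_mul {μ : Measure X} {S : Set X} (h0 : μ S ≠ 0) (ht : μ S ≠ ∞)
    (a b : ℝ≥0∞) {h : X → ℝ≥0∞} (hh : Measurable h) :
    setAvg μ S (fun y => a + b * h y) = a + b * setAvg μ S h := by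
  have h1 := setAvg_const h0 ht a
  unfold setAvg at *
  rw [lintegral_add_left measurable_const, ENNReal.add_div, h1, lintegral_const_mul _ hh,
    mul_div_assoc]

theorem setAvg_le_of_subset {μ : Measure X} {S T : Set X} {c : ℝ≥0∞} (hST : S ⊆ T)
    (hc : (μ S)⁻¹ ≤ c * (μ T)⁻¹) (f : X → ℝ≥0∞) : setAvg μ S f ≤ c * setAvg μ T f := by
  unfold setAvg
  rw [ENNReal.div_eq_inv_mul, ENNReal.div_eq_inv_mul, ← mul_assoc]
  exact mul_le_mul' hc (lintegral_mono_set hST)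

/-- Jensen's inequality for averages. -/
theorem setAvg_rpow_le {μ : Measure X} {S : Set X} (h0 : μ S ≠ 0) (ht : μ S ≠ ∞)
    {s : ℝ} (hs : 1 ≤ s) {f : X → ℝ≥0∞} (hf : Measurable f) :
    setAvg μ S f ^ s ≤ setAvg μ S (fun y => f y ^ s) := by
  rcases hs.eq_or_lt with rfl | hs
  · simp
  have hs0 : 0 < s := by linarith
  have hpq := Real.HolderConjugate.conjExponent hs
  have := ENNReal.lintegral_mul_le_Lp_mul_Lq (μ.restrict S) hpq hf.aemeasurable
    (measurable_const (a := (1 : ℝ≥0∞))).aemeasurable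
  simp only [Pi.mul_apply, mul_one, ENNReal.one_rpow, lintegral_const, one_mul,
    Measure.restrict_apply MeasurableSet.univ, univ_inter] at this
  unfold setAvg
  rw [ENNReal.div_eq_inv_mul, ENNReal.div_eq_inv_mul, ENNReal.mul_rpow_of_nonneg _ _ hs0.le]
  calc (μ S)⁻¹ ^ s * (∫⁻ y in S, f y ∂μ) ^ s
      ≤ (μ S)⁻¹ ^ s * ((∫⁻ y in S, f y ^ s ∂μ) ^ (1 / s) * μ S ^ (1 / s.conjExponent)) ^ s := by
        gcongr
    _ = ((μ S)⁻¹ ^ s * μ S ^ (s - 1)) * ∫⁻ y in S, f y ^ s ∂μ := by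
        rw [ENNReal.mul_rpow_of_nonneg _ _ hs0.le, ← ENNReal.rpow_mul, ← ENNReal.rpow_mul,
          one_div_mul_cancel hs0.ne', ENNReal.rpow_one]
        have : 1 / s.conjExponent * s = s - 1 := by
          have h2 : s - 1 ≠ 0 := by linarith
          rw [Real.conjExponent]; field_simp
        rw [this]; ring
    _ = _ := by
        rw [ENNReal.inv_rpow, ← ENNReal.rpow_neg, ← ENNReal.rpow_add _ _ h0 ht,
          show -s + (s - 1) = -1 by ring, ENNReal.rpow_neg_one]

/-- The averaging operator is self-adjoint up to the doubling constant. -/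
theorem lintegral_avg_mul_le [SecondCountableTopology X] {μ : Measure X} [SFinite μ] {c : ℝ≥0∞}
    (h : DoublingMeasure μ c) {r : ℝ} (hr : 0 < r) {f g : X → ℝ≥0∞}
    (hf : Measurable f) (hg : Measurable g) :
    ∫⁻ x, avg μ r f x * g x ∂μ ≤ c * ∫⁻ x, f x * avg μ r g x ∂μ := by
  set D : Set (X × X) := {z : X × X | dist z.2 z.1 < r}
  have hD : MeasurableSet D := measurableSet_dist_lt r
  have key : ∀ x y, D.indicator (fun z => (μ (ball z.1 r))⁻¹ * f z.2 * g z.1) (x, y) ≤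
      D.indicator (fun z => c * ((μ (ball z.2 r))⁻¹ * f z.2 * g z.1)) (x, y) := by
    intro x y
    by_cases hxy : (x, y) ∈ D
    · rw [indicator_of_mem hxy, indicator_of_mem hxy]
      have := h.inv_ball_le (x := x) (y := y) hr 1 (R := r) (by
        have : dist y x < r := hxy
        linarith)
      rw [pow_one] at this
      calc _ ≤ (c * (μ (ball y r))⁻¹) * f y * g x := by gcongr
        _ = _ := by ring
    · rw [indicator_of_notMem hxy, indicator_of_notMem hxy]
  have hm1 : Measurable fun z : X × X => (μ (ball z.2 r))⁻¹ * f z.2 * g z.1 :=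
    ((((measurable_measure_ball r).comp measurable_snd).inv).mul (hf.comp measurable_snd)).mul
      (hg.comp measurable_fst)
  calc ∫⁻ x, avg μ r f x * g x ∂μ
      = ∫⁻ x, ∫⁻ y, D.indicator (fun z => (μ (ball z.1 r))⁻¹ * f z.2 * g z.1) (x, y) ∂μ ∂μ := by
        refine lintegral_congr fun x => ?_
        have e : ∀ y, D.indicator (fun z => (μ (ball z.1 r))⁻¹ * f z.2 * g z.1) (x, y) =
            ((μ (ball x r))⁻¹ * g x) * (ball x r).indicator f y := by
          intro y
          by_cases hxy : y ∈ ball x r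
          · rw [indicator_of_mem hxy, indicator_of_mem (show (x, y) ∈ D from hxy)]; ring
          · rw [indicator_of_notMem hxy, indicator_of_notMem (show (x, y) ∉ D from hxy), mul_zero]
        simp_rw [e]
        rw [lintegral_const_mul _ (hf.indicator measurableSet_ball),
          lintegral_indicator measurableSet_ball, avg, setAvg, ENNReal.div_eq_inv_mul]
        ring
    _ ≤ ∫⁻ x, ∫⁻ y, D.indicator (fun z => c * ((μ (ball z.2 r))⁻¹ * f z.2 * g z.1)) (x, y) ∂μ ∂μ :=
        lintegral_mono fun x => lintegral_mono fun y => key x y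
    _ = ∫⁻ y, ∫⁻ x, D.indicator (fun z => c * ((μ (ball z.2 r))⁻¹ * f z.2 * g z.1)) (x, y) ∂μ ∂μ :=
        lintegral_lintegral_swap (((hm1.const_mul c).indicator hD).aemeasurable)
    _ = ∫⁻ y, c * (f y * avg μ r g y) ∂μ := by
        refine lintegral_congr fun y => ?_
        have e : ∀ x, D.indicator (fun z => c * ((μ (ball z.2 r))⁻¹ * f z.2 * g z.1)) (x, y) =
            (c * (μ (ball y r))⁻¹ * f y) * (ball y r).indicator g x := by
          intro x
          by_cases hxy : dist y x < r
          · rw [indicator_of_mem (show x ∈ ball y r by rwa [mem_ball']),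
              indicator_of_mem (show (x, y) ∈ D from hxy)]; ring
          · rw [indicator_of_notMem (show x ∉ ball y r by rwa [mem_ball']),
              indicator_of_notMem (show (x, y) ∉ D from hxy), mul_zero]
        simp_rw [e]
        rw [lintegral_const_mul _ (hg.indicator measurableSet_ball),
          lintegral_indicator measurableSet_ball, avg, setAvg, ENNReal.div_eq_inv_mul]
        ring
    _ = c * ∫⁻ x, f x * avg μ r g x ∂μ := by
        exact lintegral_const_mul _ (hf.mul (measurable_avg r hg))


/-! ### Geometric sums -/

theorem two_rpow_add (a b : ℝ) : (2 : ℝ≥0∞) ^ (a + b) = 2 ^ a * 2 ^ b :=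
  ENNReal.rpow_add a b two_ne_zero ENNReal.ofNat_ne_top

theorem two_rpow_ne_top (a : ℝ) : (2 : ℝ≥0∞) ^ a ≠ ∞ := by simp

theorem two_rpow_ne_zero (a : ℝ) : (2 : ℝ≥0∞) ^ a ≠ 0 := by simp

theorem two_rpow_mono {a b : ℝ} (h : a ≤ b) : (2 : ℝ≥0∞) ^ a ≤ 2 ^ b :=
  ENNReal.rpow_le_rpow_of_exponent_le one_le_two h

theorem ofReal_two_rpow (a : ℝ) : ENNReal.ofReal ((2 : ℝ) ^ a) = 2 ^ a := by
  rw [← ENNReal.ofReal_rpow_of_pos two_pos, ENNReal.ofReal_ofNat]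

theorem ofReal_two_zpow (n : ℤ) : ENNReal.ofReal ((2 : ℝ) ^ n) = 2 ^ (n : ℝ) := by
  rw [← Real.rpow_intCast, ofReal_two_rpow]

/-- The two-sided geometric sum `∑ 2^{-ε|n|}`. -/
def geo (ε : ℝ) : ℝ≥0∞ := ∑' n : ℤ, (2 : ℝ≥0∞) ^ (-ε * |(n : ℝ)|)

theorem geo_ne_top {ε : ℝ} (hε : 0 < ε) : geo ε ≠ ∞ := by
  have hlt : (2 : ℝ) ^ (-ε) < 1 := Real.rpow_lt_one_of_one_lt_of_neg one_lt_two (by linarith)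
  have hs : Summable fun n : ℕ => ((2 : ℝ) ^ (-ε)) ^ n :=
    summable_geometric_of_lt_one (by positivity) hlt
  have hs2 : Summable fun n : ℤ => (2 : ℝ) ^ (-ε * |(n : ℝ)|) := by
    refine Summable.of_nat_of_neg ?_ ?_ <;>
    · refine hs.congr fun n => ?_
      rw [Real.rpow_mul zero_le_two, ← Real.rpow_natCast]
      simp
  simpa only [geo, ofReal_two_rpow] using hs2.tsum_ofReal_ne_top

theorem one_le_geo (ε : ℝ) : 1 ≤ geo ε := by
  have := ENNReal.le_tsum (f := fun n : ℤ => (2 : ℝ≥0∞) ^ (-ε * |(n : ℝ)|)) 0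
  simpa [geo] using this

theorem tsum_geo_left (ε : ℝ) (k : ℤ) :
    ∑' n : ℤ, (2 : ℝ≥0∞) ^ (-ε * |(n : ℝ) - k|) = geo ε := by
  have := (Equiv.subRight k).tsum_eq fun n : ℤ => (2 : ℝ≥0∞) ^ (-ε * |(n : ℝ)|)
  simpa [geo] using this

theorem tsum_geo_right (ε : ℝ) (n : ℤ) :
    ∑' k : ℤ, (2 : ℝ≥0∞) ^ (-ε * |(n : ℝ) - k|) = geo ε := by
  simp_rw [abs_sub_comm (n : ℝ)]
  exact tsum_geo_left ε n

/-! ### The maximal function -/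

/-- The maximal function over the finitely many radii `R n`, `n ∈ s`. -/
def maxAvg (μ : Measure X) (R : ℤ → ℝ) (s : Finset ℤ) (w : X → ℝ≥0∞) (x : X) : ℝ≥0∞ :=
  ⨆ n ∈ s, avg μ (R n) w x

theorem measurable_maxAvg [SecondCountableTopology X] {μ : Measure X} [SFinite μ]
    (R : ℤ → ℝ) (s : Finset ℤ) {w : X → ℝ≥0∞} (hw : Measurable w) :
    Measurable (maxAvg μ R s w) :=
  Measurable.iSup fun _ => Measurable.iSup fun _ => measurable_avg _ hw

theorem maxAvg_weak [SecondCountableTopology X] {μ : Measure X} {c : ℝ≥0∞}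
    (h : DoublingMeasure μ c) {R : ℤ → ℝ} (hR : ∀ n, 0 < R n) (s : Finset ℤ)
    (w : X → ℝ≥0∞) (t : ℝ≥0∞) :
    t * μ {x | t < maxAvg μ R s w x} ≤ c ^ 3 * ∫⁻ y, w y ∂μ := by
  have hsel : ∀ x, ∃ n, t < maxAvg μ R s w x → n ∈ s ∧ t < avg μ (R n) w x := by
    intro x
    by_cases hx : t < maxAvg μ R s w x
    · simp only [maxAvg, lt_iSup_iff] at hx
      obtain ⟨n, hn, hlt⟩ := hx
      exact ⟨n, fun _ => ⟨hn, hlt⟩⟩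
    · exact ⟨0, fun h => absurd h hx⟩
  choose N hN using hsel
  obtain ⟨M, hM⟩ := (s.finite_toSet.image R).bddAbove
  obtain ⟨u, huS, hdisj, hcov⟩ := Vitali.exists_disjoint_subfamily_covering_enlargement_closedBall
    {x | t < maxAvg μ R s w x} id (fun x => R (N x)) M
    (fun x hx => hM (mem_image_of_mem _ (hN x hx).1)) 4 (by norm_num)
  have hdisj' : u.PairwiseDisjoint fun a => ball a (R (N a)) := fun a ha b hb hab =>
    (hdisj ha hb hab).mono ball_subset_closedBall ball_subset_closedBall
  have hcount : u.Countable := hdisj'.countable_of_isOpen (fun _ _ => isOpen_ball)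
    fun a _ => nonempty_ball.mpr (hR _)
  have hsub : {x | t < maxAvg μ R s w x} ⊆ ⋃ b ∈ u, ball b (2 ^ 3 * R (N b)) := by
    intro x hx
    obtain ⟨b, hb, hxb⟩ := hcov x hx
    refine mem_biUnion hb ?_
    have := hxb (mem_closedBall_self (hR _).le)
    simp only [id, mem_closedBall] at this
    rw [mem_ball]
    have := hR (N b)
    linarith
  calc t * μ {x | t < maxAvg μ R s w x}
      ≤ t * ∑' b : u, μ (ball (b : X) (2 ^ 3 * R (N b))) := by
        gcongr
        exact (measure_mono hsub).trans (measure_biUnion_le μ hcount _)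
    _ ≤ t * ∑' b : u, c ^ 3 * μ (ball (b : X) (R (N b))) := by
        gcongr with b
        exact h.ball_pow_le _ (hR _) 3
    _ = c ^ 3 * ∑' b : u, t * μ (ball (b : X) (R (N b))) := by
        rw [ENNReal.tsum_mul_left, ENNReal.tsum_mul_left]; ring
    _ ≤ c ^ 3 * ∑' b : u, ∫⁻ y in ball (b : X) (R (N b)), w y ∂μ := by
        gcongr with b
        have := (hN b (huS b.2)).2.le
        rwa [avg, setAvg, ENNReal.le_div_iff_mul_le (Or.inl (h.pos _ _ (hR _)).ne')
          (Or.inl (h.fin _ _))] at this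
    _ = c ^ 3 * ∫⁻ y in ⋃ b ∈ u, ball (b : X) (R (N b)), w y ∂μ := by
        rw [lintegral_biUnion hcount (fun _ _ => measurableSet_ball) hdisj']
    _ ≤ c ^ 3 * ∫⁻ y, w y ∂μ := by
        exact mul_le_mul' le_rfl (setLIntegral_le_lintegral _ _)

theorem maxAvg_weak_trunc [SecondCountableTopology X] {μ : Measure X} {c : ℝ≥0∞}
    (h : DoublingMeasure μ c) {R : ℤ → ℝ} (hR : ∀ n, 0 < R n) (s : Finset ℤ)
    {w : X → ℝ≥0∞} (hw : Measurable w) {t : ℝ≥0∞} (ht : t ≠ ∞) :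
    t * μ {x | 2 * t < maxAvg μ R s w x} ≤ c ^ 3 * ∫⁻ y, {y | t < w y}.indicator w y ∂μ := by
  refine le_trans ?_ (maxAvg_weak h hR s _ t)
  refine mul_le_mul' le_rfl (measure_mono fun x (hx : 2 * t < maxAvg μ R s w x) => ?_)
  show t < maxAvg μ R s _ x
  simp only [maxAvg, lt_iSup_iff] at hx ⊢
  obtain ⟨n, hn, hlt⟩ := hx
  refine ⟨n, hn, ?_⟩
  have hmeas : Measurable ({y | t < w y}.indicator w) :=
    hw.indicator (measurableSet_lt measurable_const hw)
  have h1 : avg μ (R n) w x ≤ t + avg μ (R n) ({y | t < w y}.indicator w) x := by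
    have h2 := setAvg_const_add_mul (μ := μ) (S := ball x (R n)) (h.pos x _ (hR n)).ne'
      (h.fin _ _) t 1 hmeas
    rw [one_mul] at h2
    unfold avg
    rw [← h2]
    refine setAvg_mono fun y => ?_
    by_cases hy : t < w y
    · rw [indicator_of_mem (by exact hy)]; simp
    · exact (not_lt.mp hy).trans le_self_add
  have h3 := hlt.trans_le h1
  rw [two_mul] at h3
  exact (ENNReal.add_lt_add_iff_left ht).mp h3

theorem rpow_le_dyadic_sum {s : ℝ} (hs : 0 < s) (a : ℝ≥0∞) :
    a ^ s ≤ ∑' k : ℤ, (2 : ℝ≥0∞) ^ (((k : ℝ) + 2) * s) *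
      {b : ℝ≥0∞ | 2 * 2 ^ (k : ℝ) < b}.indicator 1 a := by
  rcases eq_or_ne a 0 with rfl | h0
  · simp [hs]
  rcases eq_or_ne a ∞ with rfl | ht
  · have h1 : ∑' k : ℕ, (2 : ℝ≥0∞) ^ ((((k : ℤ) : ℝ) + 2) * s) *
        {b : ℝ≥0∞ | 2 * 2 ^ (((k : ℤ) : ℝ)) < b}.indicator 1 ∞ = ∞ := by
      refine eq_top_iff.mpr
        ((ENNReal.tsum_const_eq_top_of_ne_zero (α := ℕ) one_ne_zero).ge.trans ?_)
      refine ENNReal.tsum_le_tsum fun k => ?_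
      rw [indicator_of_mem]
      · simp only [Pi.one_apply, mul_one]
        exact ENNReal.one_le_rpow one_le_two (by positivity)
      · have h3 : (2 : ℝ≥0∞) * 2 ^ ((k : ℤ) : ℝ) ≠ ∞ :=
          ENNReal.mul_ne_top ENNReal.ofNat_ne_top (two_rpow_ne_top _)
        exact h3.lt_top
    have h2 := ENNReal.tsum_comp_le_tsum_of_injective Nat.cast_injective
      (fun k : ℤ => (2 : ℝ≥0∞) ^ (((k : ℝ) + 2) * s) *
        {b : ℝ≥0∞ | 2 * 2 ^ (k : ℝ) < b}.indicator 1 ∞)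
    rw [h1] at h2
    exact le_top.trans h2
  · obtain ⟨m, hm1, hm2⟩ := ENNReal.exists_mem_Ioc_zpow h0 ht ENNReal.one_lt_two ENNReal.ofNat_ne_top
    refine le_trans ?_ (ENNReal.le_tsum (m - 1))
    rw [indicator_of_mem]
    · simp only [Pi.one_apply, mul_one]
      rw [← ENNReal.rpow_intCast] at hm2
      calc a ^ s ≤ ((2 : ℝ≥0∞) ^ (((m + 1 : ℤ)) : ℝ)) ^ s := by gcongr
        _ = _ := by
          rw [← ENNReal.rpow_mul]; congr 1; push_cast; ring
    · have : (2 : ℝ≥0∞) * 2 ^ (((m - 1 : ℤ)) : ℝ) = 2 ^ m := by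
        rw [← ENNReal.rpow_intCast]
        nth_rw 1 [← ENNReal.rpow_one 2]
        rw [← two_rpow_add]; congr 1; push_cast; ring
      show (2 : ℝ≥0∞) * 2 ^ (((m - 1 : ℤ)) : ℝ) < a
      rwa [this]

theorem mul_dyadic_sum_le {s : ℝ} (hs : 1 < s) (a : ℝ≥0∞) :
    a * ∑' k : ℤ, (2 : ℝ≥0∞) ^ (((k : ℝ) + 2) * s - k) *
      {b : ℝ≥0∞ | 2 ^ (k : ℝ) < b}.indicator 1 a ≤ 2 ^ (2 * s) * geo (s - 1) * a ^ s := by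
  rcases eq_or_ne a 0 with rfl | h0
  · simp
  have hC : (2 : ℝ≥0∞) ^ (2 * s) * geo (s - 1) ≠ 0 :=
    mul_ne_zero (two_rpow_ne_zero _) (one_pos.trans_le (one_le_geo _)).ne'
  rcases eq_or_ne a ∞ with rfl | ht
  · rw [ENNReal.top_rpow_of_pos (by linarith), ENNReal.mul_top hC]
    exact le_top
  · obtain ⟨m, hm1, hm2⟩ := ENNReal.exists_mem_Ioc_zpow h0 ht ENNReal.one_lt_two ENNReal.ofNat_ne_top
    have hsplit : a ^ s = a * a ^ (s - 1) := by
      nth_rw 2 [← ENNReal.rpow_one a]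
      rw [← ENNReal.rpow_add _ _ h0 ht]; congr 1; ring
    rw [hsplit, mul_left_comm]
    gcongr
    rw [← tsum_geo_left (s - 1) m, mul_assoc, ← ENNReal.tsum_mul_right, ← ENNReal.tsum_mul_left]
    refine ENNReal.tsum_le_tsum fun k => ?_
    by_cases hk : (2 : ℝ≥0∞) ^ (k : ℝ) < a
    · rw [indicator_of_mem (by exact hk)]
      have hkm : k ≤ m := by
        by_contra! hlt
        have h1 : (2 : ℝ≥0∞) ^ (m + 1) ≤ 2 ^ (k : ℝ) := by
          rw [ENNReal.rpow_intCast]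
          exact ENNReal.zpow_le_of_le one_le_two (by lia)
        exact absurd (hm2.trans h1) (not_le.mpr hk)
      have hkm' : (k : ℝ) ≤ m := by exact_mod_cast hkm
      have h2 : (2 : ℝ≥0∞) ^ ((m : ℝ) * (s - 1)) ≤ a ^ (s - 1) := by
        rw [ENNReal.rpow_mul, ENNReal.rpow_intCast]
        exact ENNReal.rpow_le_rpow hm1.le (by linarith)
      calc (2 : ℝ≥0∞) ^ (((k : ℝ) + 2) * s - k) * (1 : ℝ≥0∞ → ℝ≥0∞) a
          = 2 ^ (2 * s) * (2 ^ (-(s - 1) * |(k : ℝ) - m|) * 2 ^ ((m : ℝ) * (s - 1))) := by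
            rw [abs_of_nonpos (by linarith), ← two_rpow_add, ← two_rpow_add, Pi.one_apply,
              mul_one]
            congr 1; ring
        _ ≤ _ := by gcongr
    · rw [indicator_of_notMem (by exact hk)]
      simp

/-- The constant in the strong maximal inequality on `L^s`. -/
def maxConst (c : ℝ≥0∞) (s : ℝ) : ℝ≥0∞ := c ^ 3 * (2 ^ (2 * s) * geo (s - 1))

theorem maxConst_ne_top {c : ℝ≥0∞} (hc : c ≠ ∞) {s : ℝ} (hs : 1 < s) : maxConst c s ≠ ∞ :=
  ENNReal.mul_ne_top (ENNReal.pow_ne_top hc)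
    (ENNReal.mul_ne_top (two_rpow_ne_top _) (geo_ne_top (by linarith)))

/-- The Hardy-Littlewood maximal inequality. -/
theorem lintegral_maxAvg_rpow_le [SecondCountableTopology X] {μ : Measure X} [SFinite μ]
    {c : ℝ≥0∞} (h : DoublingMeasure μ c) {R : ℤ → ℝ} (hR : ∀ n, 0 < R n) (s : Finset ℤ)
    {p : ℝ} (hp : 1 < p) {w : X → ℝ≥0∞} (hw : Measurable w) :
    ∫⁻ x, maxAvg μ R s w x ^ p ∂μ ≤ maxConst c p * ∫⁻ x, w x ^ p ∂μ := by
  have hM := measurable_maxAvg (μ := μ) R s hw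
  have hind1 : ∀ k : ℤ, Measurable ({b : ℝ≥0∞ | 2 * 2 ^ (k : ℝ) < b}.indicator
      (1 : ℝ≥0∞ → ℝ≥0∞)) := fun k =>
    measurable_one.indicator (measurableSet_lt measurable_const measurable_id)
  have hind2 : ∀ k : ℤ, Measurable ({b : ℝ≥0∞ | 2 ^ (k : ℝ) < b}.indicator
      (1 : ℝ≥0∞ → ℝ≥0∞)) := fun k =>
    measurable_one.indicator (measurableSet_lt measurable_const measurable_id)
  have hm1 : ∀ k : ℤ, Measurable fun x =>
      {b : ℝ≥0∞ | 2 * 2 ^ (k : ℝ) < b}.indicator (1 : ℝ≥0∞ → ℝ≥0∞) (maxAvg μ R s w x) :=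
    fun k => (hind1 k).comp hM
  have hm2 : ∀ k : ℤ, Measurable fun y => w y * ((2 : ℝ≥0∞) ^ (((k : ℝ) + 2) * p - k) *
      {b : ℝ≥0∞ | 2 ^ (k : ℝ) < b}.indicator 1 (w y)) :=
    fun k => hw.mul (((hind2 k).comp hw).const_mul _)
  calc ∫⁻ x, maxAvg μ R s w x ^ p ∂μ
      ≤ ∫⁻ x, ∑' k : ℤ, (2 : ℝ≥0∞) ^ (((k : ℝ) + 2) * p) *
          {b : ℝ≥0∞ | 2 * 2 ^ (k : ℝ) < b}.indicator 1 (maxAvg μ R s w x) ∂μ :=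
        lintegral_mono fun x => rpow_le_dyadic_sum (by linarith) _
    _ = ∑' k : ℤ, (2 : ℝ≥0∞) ^ (((k : ℝ) + 2) * p) *
          μ {x | 2 * 2 ^ (k : ℝ) < maxAvg μ R s w x} := by
        rw [lintegral_tsum fun k => ((hm1 k).const_mul _).aemeasurable]
        refine tsum_congr fun k => ?_
        rw [lintegral_const_mul _ (hm1 k)]
        congr 1
        rw [← lintegral_indicator_one (measurableSet_lt measurable_const hM)]
        rfl
    _ ≤ ∑' k : ℤ, (2 : ℝ≥0∞) ^ (((k : ℝ) + 2) * p - k) *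
          (c ^ 3 * ∫⁻ y, {y | 2 ^ (k : ℝ) < w y}.indicator w y ∂μ) := by
        refine ENNReal.tsum_le_tsum fun k => ?_
        have := maxAvg_weak_trunc h hR s hw (two_rpow_ne_top (k : ℝ))
        rw [show ((k : ℝ) + 2) * p = (((k : ℝ) + 2) * p - k) + k by ring, two_rpow_add, mul_assoc]
        simp only [add_sub_cancel_right]
        gcongr
    _ = ∑' k : ℤ, c ^ 3 * ∫⁻ y, w y * ((2 : ℝ≥0∞) ^ (((k : ℝ) + 2) * p - k) *
          {b : ℝ≥0∞ | 2 ^ (k : ℝ) < b}.indicator 1 (w y)) ∂μ := by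
        refine tsum_congr fun k => ?_
        rw [mul_left_comm, ← lintegral_const_mul _
          (hw.indicator (measurableSet_lt measurable_const hw))]
        congr 1
        refine lintegral_congr fun y => ?_
        by_cases hy : (2 : ℝ≥0∞) ^ (k : ℝ) < w y
        · rw [indicator_of_mem (by exact hy), indicator_of_mem (by exact hy)]
          simp [mul_comm]
        · rw [indicator_of_notMem (by exact hy), indicator_of_notMem (by exact hy)]
          simp
    _ = c ^ 3 * ∫⁻ y, w y * ∑' k : ℤ, ((2 : ℝ≥0∞) ^ (((k : ℝ) + 2) * p - k) *
          {b : ℝ≥0∞ | 2 ^ (k : ℝ) < b}.indicator 1 (w y)) ∂μ := by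
        rw [ENNReal.tsum_mul_left, ← lintegral_tsum fun k => (hm2 k).aemeasurable]
        simp_rw [ENNReal.tsum_mul_left]
    _ ≤ c ^ 3 * ∫⁻ y, 2 ^ (2 * p) * geo (p - 1) * w y ^ p ∂μ := by
        exact mul_le_mul' le_rfl (lintegral_mono fun y => mul_dyadic_sum_le hp _)
    _ = maxConst c p * ∫⁻ x, w x ^ p ∂μ := by
        rw [lintegral_const_mul _ (hw.pow_const p), maxConst]; ring


/-! ### Vector-valued inequality for averages -/

theorem rpow_mul_rpow_sub_one {t : ℝ} (ht : 1 < t) (a : ℝ≥0∞) :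
    a * a ^ (t - 1) = a ^ t := by
  have := ENNReal.rpow_add_of_nonneg (x := a) 1 (t - 1) zero_le_one (by linarith)
  rw [ENNReal.rpow_one] at this
  rw [← this]; congr 1; ring

/-- A converse to Hölder's inequality. -/
theorem lintegral_rpow_le_of_forall_mul {μ : Measure X} [SigmaFinite μ] {t t' : ℝ}
    (ht : t.HolderConjugate t') {F : X → ℝ≥0∞} (hF : Measurable F) {K : ℝ≥0∞}
    (hK : ∀ w : X → ℝ≥0∞, Measurable w →
      ∫⁻ x, F x * w x ∂μ ≤ K * (∫⁻ x, w x ^ t' ∂μ) ^ (1 / t')) :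
    ∫⁻ x, F x ^ t ∂μ ≤ K ^ t := by
  have ht0 : 0 < t := ht.pos
  have ht1 : 1 < t := ht.lt
  set G : ℕ → X → ℝ≥0∞ := fun N => (spanningSets μ N).indicator fun x => min (F x) N
  have hG : ∀ N, Measurable (G N) := fun N =>
    (hF.min measurable_const).indicator (measurableSet_spanningSets μ N)
  have hGF : ∀ N x, G N x ≤ F x := fun N x =>
    (indicator_le_self _ _ x).trans (min_le_left _ _)
  have hbd : ∀ N, ∫⁻ x, G N x ^ t ∂μ ≤ K ^ t := by
    intro N
    set I := ∫⁻ x, G N x ^ t ∂μ with hI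
    have hIfin : I ≠ ∞ := by
      have : I ≤ ∫⁻ x, (spanningSets μ N).indicator (fun _ => (N : ℝ≥0∞) ^ t) x ∂μ := by
        refine lintegral_mono fun x => ?_
        by_cases hx : x ∈ spanningSets μ N
        · simp only [G, indicator_of_mem hx]
          gcongr
          exact min_le_right _ _
        · simp [G, indicator_of_notMem hx, ht0]
      refine ne_top_of_le_ne_top ?_ this
      rw [lintegral_indicator (measurableSet_spanningSets μ N), setLIntegral_const]
      exact ENNReal.mul_ne_top (ENNReal.rpow_ne_top_of_nonneg ht0.le (ENNReal.natCast_ne_top N))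
        (measure_spanningSets_lt_top μ N).ne
    rcases eq_or_ne I 0 with h0 | h0
    · rw [h0]; exact bot_le
    have h1 : I ≤ K * I ^ (1 / t') := by
      calc I = ∫⁻ x, G N x * G N x ^ (t - 1) ∂μ := by
            refine lintegral_congr fun x => ?_
            rw [rpow_mul_rpow_sub_one ht1]
        _ ≤ ∫⁻ x, F x * G N x ^ (t - 1) ∂μ := by
            refine lintegral_mono fun x => ?_
            exact mul_le_mul' (hGF N x) le_rfl
        _ ≤ K * (∫⁻ x, (G N x ^ (t - 1)) ^ t' ∂μ) ^ (1 / t') := hK _ ((hG N).pow_const _)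
        _ = K * I ^ (1 / t') := by
            simp_rw [← ENNReal.rpow_mul, ht.sub_one_mul_conj]
            rfl
    have h2 : I = I ^ (1 / t) * I ^ (1 / t') := by
      rw [← ENNReal.rpow_add _ _ h0 hIfin, one_div, one_div, ht.inv_add_inv_eq_one,
        ENNReal.rpow_one]
    nth_rw 1 [h2] at h1
    have hp0 : I ^ (1 / t') ≠ 0 := by simp [h0, hIfin]
    have hpt : I ^ (1 / t') ≠ ∞ :=
      ENNReal.rpow_ne_top_of_nonneg (by have := ht.symm.pos; positivity) hIfin
    have h3 : I ^ (1 / t) ≤ K := (ENNReal.mul_le_mul_iff_left hp0 hpt).mp h1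
    calc I = (I ^ (1 / t)) ^ t := by
          rw [← ENNReal.rpow_mul, one_div_mul_cancel ht0.ne', ENNReal.rpow_one]
      _ ≤ K ^ t := by gcongr
  refine le_of_tendsto' (lintegral_tendsto_of_tendsto_of_monotone
    (f := fun N x => G N x ^ t) (F := fun x => F x ^ t)
    (fun N => ((hG N).pow_const t).aemeasurable) ?_ ?_) hbd
  · refine Filter.Eventually.of_forall fun x M N hMN => ?_
    refine ENNReal.rpow_le_rpow ?_ ht0.le
    by_cases hx : x ∈ spanningSets μ M
    · simp only [G, indicator_of_mem hx, indicator_of_mem (monotone_spanningSets μ hMN hx)]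
      gcongr
    · simp [G, indicator_of_notMem hx]
  · refine Filter.Eventually.of_forall fun x => ?_
    have h1 : Filter.Tendsto (fun N : ℕ => min (F x) (N : ℝ≥0∞)) Filter.atTop (nhds (F x)) := by
      have := (tendsto_const_nhds (x := F x) (f := Filter.atTop)).min ENNReal.tendsto_nat_nhds_top
      simpa using this
    refine ((ENNReal.continuous_rpow_const (y := t)).tendsto _).comp (h1.congr' ?_)
    filter_upwards [Filter.eventually_ge_atTop (spanningSetsIndex μ x)] with N hN
    simp only [G]
    rw [indicator_of_mem (monotone_spanningSets μ hN (mem_spanningSetsIndex μ x))]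

theorem avg_rpow_le_lintegral {μ : Measure X} {c : ℝ≥0∞} (h : DoublingMeasure μ c)
    {r : ℝ} (hr : 0 < r) {p : ℝ} (hp : 1 ≤ p) {f : X → ℝ≥0∞} (hf : Measurable f) (x : X) :
    avg μ r f x ^ p ≤ (∫⁻ y, f y ^ p ∂μ) / μ (ball x r) := by
  refine (setAvg_rpow_le (h.pos x r hr).ne' (h.fin x r) hp hf).trans ?_
  exact ENNReal.div_le_div_right (setLIntegral_le_lintegral _ _) _

theorem avg_one {μ : Measure X} {c : ℝ≥0∞} (h : DoublingMeasure μ c) {r : ℝ} (hr : 0 < r)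
    (x : X) : avg μ r (fun _ => 1) x = 1 :=
  setAvg_const (h.pos x r hr).ne' (h.fin x r) 1

theorem lintegral_sum_avg_rpow_mul_le [SecondCountableTopology X] {μ : Measure X} [SFinite μ]
    {c : ℝ≥0∞} (h : DoublingMeasure μ c) {R : ℤ → ℝ} (hR : ∀ n, 0 < R n) (s : Finset ℤ)
    {q : ℝ} (hq : 1 ≤ q) {f : ℤ → X → ℝ≥0∞} (hf : ∀ n, Measurable (f n))
    {w : X → ℝ≥0∞} (hw : Measurable w) :
    ∫⁻ x, (∑ n ∈ s, avg μ (R n) (f n) x ^ q) * w x ∂μ ≤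
      c * ∫⁻ x, ∑ n ∈ s, f n x ^ q * avg μ (R n) w x ∂μ := by
  have hfq : ∀ n, Measurable fun y => f n y ^ q := fun n => (hf n).pow_const q
  have h1 : ∀ n, Measurable fun x => avg μ (R n) (f n) x ^ q * w x := fun n =>
    ((measurable_avg _ (hf n)).pow_const q).mul hw
  have h2 : ∀ n, Measurable fun x => f n x ^ q * avg μ (R n) w x := fun n =>
    (hfq n).mul (measurable_avg _ hw)
  simp_rw [Finset.sum_mul]
  rw [lintegral_finsetSum _ fun n _ => h1 n, lintegral_finsetSum _ fun n _ => h2 n,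
    Finset.mul_sum]
  refine Finset.sum_le_sum fun n _ => ?_
  refine le_trans (lintegral_mono fun x => ?_) (lintegral_avg_mul_le h (hR n) (hfq n) hw)
  exact mul_le_mul'
    (setAvg_rpow_le (h.pos _ _ (hR n)).ne' (h.fin _ _) hq (hf n)) le_rfl

/-- Vector-valued inequality for averages, `q ≤ p`. -/
theorem exists_lintegral_sum_avg_le_of_le [SecondCountableTopology X] {μ : Measure X}
    [SigmaFinite μ] {c : ℝ≥0∞} (h : DoublingMeasure μ c) {R : ℤ → ℝ} (hR : ∀ n, 0 < R n)
    {p q : ℝ} (hq : 1 ≤ q) (hqp : q ≤ p) :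
    ∃ C : ℝ≥0∞, C ≠ ∞ ∧ ∀ (s : Finset ℤ) (f : ℤ → X → ℝ≥0∞), (∀ n, Measurable (f n)) →
      ∫⁻ x, (∑ n ∈ s, avg μ (R n) (f n) x ^ q) ^ (p / q) ∂μ ≤
        C * ∫⁻ x, (∑ n ∈ s, f n x ^ q) ^ (p / q) ∂μ := by
  have hq0 : 0 < q := by linarith
  rcases hqp.eq_or_lt with rfl | hlt
  · refine ⟨c, h.ne_top, fun s f hf => ?_⟩
    have := lintegral_sum_avg_rpow_mul_le h hR s hq hf (w := fun _ => 1) measurable_const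
    simp_rw [avg_one h (hR _), mul_one] at this
    simpa [div_self hq0.ne'] using this
  · set t := p / q
    have ht : 1 < t := (one_lt_div hq0).mpr hlt
    have ht0 : 0 < t := by linarith
    have htt := Real.HolderConjugate.conjExponent ht
    set t' := t.conjExponent
    have ht' : 1 < t' := htt.symm.lt
    refine ⟨(c * maxConst c t' ^ (1 / t')) ^ t, ENNReal.rpow_ne_top_of_nonneg ht0.le
      (ENNReal.mul_ne_top h.ne_top (ENNReal.rpow_ne_top_of_nonneg (by positivity)
        (maxConst_ne_top h.ne_top ht'))), fun s f hf => ?_⟩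
    have hS : Measurable fun x => ∑ n ∈ s, f n x ^ q :=
      Finset.measurable_fun_sum _ fun n _ => (hf n).pow_const q
    set A := ∫⁻ x, (∑ n ∈ s, f n x ^ q) ^ t ∂μ
    have key := lintegral_rpow_le_of_forall_mul (μ := μ) htt
      (F := fun x => ∑ n ∈ s, avg μ (R n) (f n) x ^ q)
      (K := c * maxConst c t' ^ (1 / t') * A ^ (1 / t))
      (Finset.measurable_fun_sum _ fun n _ => (measurable_avg _ (hf n)).pow_const q) ?_
    · refine key.trans (le_of_eq ?_)
      rw [ENNReal.mul_rpow_of_nonneg _ _ ht0.le, ← ENNReal.rpow_mul A,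
        one_div_mul_cancel ht0.ne', ENNReal.rpow_one]
    · intro w hw
      have hM := measurable_maxAvg (μ := μ) R s hw
      calc ∫⁻ x, (∑ n ∈ s, avg μ (R n) (f n) x ^ q) * w x ∂μ
          ≤ c * ∫⁻ x, ∑ n ∈ s, f n x ^ q * avg μ (R n) w x ∂μ :=
            lintegral_sum_avg_rpow_mul_le h hR s hq hf hw
        _ ≤ c * ∫⁻ x, (∑ n ∈ s, f n x ^ q) * maxAvg μ R s w x ∂μ := by
            refine mul_le_mul' le_rfl (lintegral_mono fun x => ?_)
            simp only [Finset.sum_mul]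
            refine Finset.sum_le_sum fun n hn => mul_le_mul' le_rfl ?_
            exact le_iSup₂ (f := fun n (_ : n ∈ s) => avg μ (R n) w x) n hn
        _ ≤ c * (A ^ (1 / t) * (∫⁻ x, maxAvg μ R s w x ^ t' ∂μ) ^ (1 / t')) :=
            mul_le_mul' le_rfl (ENNReal.lintegral_mul_le_Lp_mul_Lq μ htt hS.aemeasurable
              hM.aemeasurable)
        _ ≤ c * (A ^ (1 / t) * (maxConst c t' * ∫⁻ x, w x ^ t' ∂μ) ^ (1 / t')) := by
            gcongr
            exact lintegral_maxAvg_rpow_le h hR s ht' hw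
        _ = _ := by
            rw [ENNReal.mul_rpow_of_nonneg _ _ (by positivity)]; ring

/-- Every finite family of reals is normed by a dual element. -/
theorem exists_dual_weights (s : Finset ℤ) {q q' : ℝ} (hqq : q.HolderConjugate q') :
    ∃ a : (ℤ → ℝ≥0∞) → ℤ → ℝ≥0∞, (∀ n, Measurable fun b => a b n) ∧
      (∀ b, ∑ n ∈ s, a b n ^ q' ≤ 1) ∧
      ∀ b, (∀ n ∈ s, b n ≠ ∞) → (∑ n ∈ s, b n ^ q) ^ (1 / q) ≤ ∑ n ∈ s, b n * a b n := by
  have hq0 := hqq.pos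
  have hq1 := hqq.lt
  have hq'0 := hqq.symm.pos
  have hS : Measurable fun b : ℤ → ℝ≥0∞ => ∑ n ∈ s, b n ^ q :=
    Finset.measurable_fun_sum _ fun n _ => (measurable_pi_apply n).pow_const q
  refine ⟨fun b n => (b n / (∑ n ∈ s, b n ^ q) ^ (1 / q)) ^ (q - 1), fun n =>
    ((measurable_pi_apply n).div (hS.pow_const _)).pow_const _, fun b => ?_, fun b hb => ?_⟩
  · simp_rw [← ENNReal.rpow_mul, hqq.sub_one_mul_conj, ENNReal.div_rpow_of_nonneg _ _ hq0.le,
      ← ENNReal.rpow_mul, one_div_mul_cancel hq0.ne', ENNReal.rpow_one, div_eq_mul_inv]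
    rw [← Finset.sum_mul, ← div_eq_mul_inv]
    exact ENNReal.div_self_le_one
  · set S := ∑ n ∈ s, b n ^ q with hSdef
    rcases eq_or_ne S 0 with h0 | h0
    · rw [h0, ENNReal.zero_rpow_of_pos (by positivity)]; exact bot_le
    have hSt : S ≠ ∞ := by
      rw [hSdef]
      exact ENNReal.sum_ne_top.mpr fun n hn => ENNReal.rpow_ne_top_of_nonneg hq0.le (hb n hn)
    refine le_of_eq ?_
    have : ∀ n, b n * (b n / S ^ (1 / q)) ^ (q - 1) = b n ^ q * S ^ (-(1 / q * (q - 1))) := by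
      intro n
      rw [ENNReal.div_rpow_of_nonneg _ _ (by linarith), ← rpow_mul_rpow_sub_one hq1,
        div_eq_mul_inv, ENNReal.rpow_neg, ENNReal.rpow_mul]
      ring
    rw [Finset.sum_congr rfl fun n _ => this n, ← Finset.sum_mul, ← hSdef]
    nth_rw 2 [← ENNReal.rpow_one S]
    rw [← ENNReal.rpow_add _ _ h0 hSt]
    congr 1
    field_simp
    ring

/-- Vector-valued inequality for averages, `p < q < ∞`. -/
theorem exists_lintegral_sum_avg_le_of_lt [SecondCountableTopology X] {μ : Measure X}
    [SigmaFinite μ] {c : ℝ≥0∞} (h : DoublingMeasure μ c) {R : ℤ → ℝ} (hR : ∀ n, 0 < R n)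
    {p q : ℝ} (hp : 1 < p) (hpq : p < q) :
    ∃ C : ℝ≥0∞, C ≠ ∞ ∧ ∀ (s : Finset ℤ) (f : ℤ → X → ℝ≥0∞), (∀ n, Measurable (f n)) →
      (∀ n ∈ s, ∀ x, avg μ (R n) (f n) x ≠ ∞) →
      ∫⁻ x, (∑ n ∈ s, avg μ (R n) (f n) x ^ q) ^ (p / q) ∂μ ≤
        C * ∫⁻ x, (∑ n ∈ s, f n x ^ q) ^ (p / q) ∂μ := by
  have hq : 1 < q := hp.trans hpq
  have hp0 : 0 < p := by linarith
  have hpp := Real.HolderConjugate.conjExponent hp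
  have hqq := Real.HolderConjugate.conjExponent hq
  set p' := p.conjExponent
  set q' := q.conjExponent
  have hp'0 := hpp.symm.pos
  have hq'0 := hqq.symm.pos
  have hqp' : q' ≤ p' := by
    simp only [p', q', Real.conjExponent]
    rw [div_le_div_iff₀ (by linarith) (by linarith)]
    linarith
  obtain ⟨C, hC, hCs⟩ := exists_lintegral_sum_avg_le_of_le h hR hqq.symm.lt.le hqp'
  refine ⟨(c * C ^ (1 / p')) ^ p, ENNReal.rpow_ne_top_of_nonneg hp0.le
      (ENNReal.mul_ne_top h.ne_top (ENNReal.rpow_ne_top_of_nonneg (by positivity) hC)),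
    fun s f hf hfin => ?_⟩
  obtain ⟨a, ham, ha1, ha2⟩ := exists_dual_weights s hqq
  set α : ℤ → X → ℝ≥0∞ := fun n x => a (fun m => avg μ (R m) (f m) x) n
  have hα : ∀ n, Measurable (α n) := fun n =>
    (ham n).comp (measurable_pi_lambda _ fun m => measurable_avg _ (hf m))
  set A := ∫⁻ x, (∑ n ∈ s, f n x ^ q) ^ (p / q) ∂μ with hA
  have hSf : Measurable fun x => (∑ n ∈ s, f n x ^ q) ^ (1 / q) :=
    (Finset.measurable_fun_sum _ fun n _ => (hf n).pow_const q).pow_const _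
  have key := lintegral_rpow_le_of_forall_mul (μ := μ) hpp
    (F := fun x => (∑ n ∈ s, avg μ (R n) (f n) x ^ q) ^ (1 / q))
    (K := c * C ^ (1 / p') * A ^ (1 / p))
    ((Finset.measurable_fun_sum _ fun n _ =>
      (measurable_avg _ (hf n)).pow_const q).pow_const _) ?_
  · simp_rw [← ENNReal.rpow_mul, one_div_mul_eq_div] at key
    refine key.trans (le_of_eq ?_)
    rw [ENNReal.mul_rpow_of_nonneg _ _ hp0.le, ← ENNReal.rpow_mul A,
      one_div_mul_cancel hp0.ne', ENNReal.rpow_one]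
  · intro w hw
    have hαw : ∀ n, Measurable fun x => α n x * w x := fun n => (hα n).mul hw
    have hSa : Measurable fun x =>
        (∑ n ∈ s, avg μ (R n) (fun y => α n y * w y) x ^ q') ^ (1 / q') :=
      (Finset.measurable_fun_sum _ fun n _ =>
        (measurable_avg _ (hαw n)).pow_const q').pow_const _
    calc ∫⁻ x, (∑ n ∈ s, avg μ (R n) (f n) x ^ q) ^ (1 / q) * w x ∂μ
        ≤ ∫⁻ x, ∑ n ∈ s, avg μ (R n) (f n) x * (α n x * w x) ∂μ := by
          refine lintegral_mono fun x => ?_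
          refine (mul_le_mul' (ha2 (fun m => avg μ (R m) (f m) x)
            fun n hn => hfin n hn x) le_rfl).trans (le_of_eq ?_)
          rw [Finset.sum_mul]
          exact Finset.sum_congr rfl fun n _ => mul_assoc _ _ _
      _ ≤ c * ∫⁻ x, ∑ n ∈ s, f n x * avg μ (R n) (fun y => α n y * w y) x ∂μ := by
          have h1 : ∀ n, Measurable fun x => avg μ (R n) (f n) x * (α n x * w x) := fun n =>
            (measurable_avg _ (hf n)).mul (hαw n)
          have h2 : ∀ n, Measurable fun x => f n x * avg μ (R n) (fun y => α n y * w y) x :=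
            fun n => (hf n).mul (measurable_avg _ (hαw n))
          rw [lintegral_finsetSum _ fun n _ => h1 n, lintegral_finsetSum _ fun n _ => h2 n,
            Finset.mul_sum]
          exact Finset.sum_le_sum fun n _ => lintegral_avg_mul_le h (hR n) (hf n) (hαw n)
      _ ≤ c * ∫⁻ x, (∑ n ∈ s, f n x ^ q) ^ (1 / q) *
            (∑ n ∈ s, avg μ (R n) (fun y => α n y * w y) x ^ q') ^ (1 / q') ∂μ :=
          mul_le_mul' le_rfl (lintegral_mono fun x => ENNReal.inner_le_Lp_mul_Lq _ _ _ hqq)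
      _ ≤ c * (A ^ (1 / p) * (∫⁻ x,
            (∑ n ∈ s, avg μ (R n) (fun y => α n y * w y) x ^ q') ^ (p' / q') ∂μ) ^ (1 / p')) := by
          refine mul_le_mul' le_rfl ((ENNReal.lintegral_mul_le_Lp_mul_Lq μ hpp hSf.aemeasurable
              hSa.aemeasurable).trans (le_of_eq ?_))
          simp_rw [← ENNReal.rpow_mul, one_div_mul_eq_div, hA]
      _ ≤ c * (A ^ (1 / p) * (C * ∫⁻ x, w x ^ p' ∂μ) ^ (1 / p')) := by
          gcongr
          refine (hCs s _ hαw).trans (mul_le_mul' le_rfl (lintegral_mono fun x => ?_))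
          have h1 : ∑ n ∈ s, (α n x * w x) ^ q' ≤ w x ^ q' := by
            simp_rw [ENNReal.mul_rpow_of_nonneg _ _ hq'0.le]
            rw [← Finset.sum_mul]
            exact (mul_le_mul' (ha1 _) le_rfl).trans (one_mul _).le
          calc (∑ n ∈ s, (α n x * w x) ^ q') ^ (p' / q') ≤ (w x ^ q') ^ (p' / q') := by gcongr
            _ = w x ^ p' := by rw [← ENNReal.rpow_mul, mul_div_cancel₀ _ hq'0.ne']
      _ = _ := by
          rw [ENNReal.mul_rpow_of_nonneg _ _ (by positivity)]; ring

theorem lintegral_rpow_iSup_le {μ : Measure X} {G : ℕ → X → ℝ≥0∞} (hG : ∀ N, Measurable (G N))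
    (hmono : Monotone G) {p : ℝ} (hp : 0 < p) {B : ℝ≥0∞} (hB : ∀ N, ∫⁻ x, G N x ^ p ∂μ ≤ B) :
    ∫⁻ x, (⨆ N, G N x) ^ p ∂μ ≤ B := by
  have : ∀ x, (⨆ N, G N x) ^ p = ⨆ N, G N x ^ p := fun x =>
    (ENNReal.orderIsoRpow p hp).map_iSup _
  simp_rw [this]
  rw [lintegral_iSup (fun N => (hG N).pow_const p)
    fun M N hMN x => ENNReal.rpow_le_rpow (hmono hMN x) hp.le]
  exact iSup_le hB

/-- The symmetric integer interval `[-N, N]`. -/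
def symmIcc (N : ℕ) : Finset ℤ := Finset.Icc (-(N : ℤ)) N

theorem symmIcc_mono : Monotone symmIcc := fun _ _ h =>
  Finset.Icc_subset_Icc (by lia) (by lia)

theorem exists_subset_symmIcc (t : Finset ℤ) : ∃ N, t ⊆ symmIcc N := by
  refine ⟨t.sup Int.natAbs, fun n hn => ?_⟩
  have := Finset.le_sup (f := Int.natAbs) hn
  simp only [symmIcc, Finset.mem_Icc]
  lia

/-- Vector-valued inequality for averages (Fefferman-Stein). -/
theorem exists_lintegral_lqNorm_avg_le [SecondCountableTopology X] {μ : Measure X}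
    [SigmaFinite μ] {c : ℝ≥0∞} (h : DoublingMeasure μ c) {R : ℤ → ℝ} (hR : ∀ n, 0 < R n)
    {p : ℝ} {q : ℝ≥0∞} (hp : 1 < p) (hq : 1 < q) :
    ∃ C : ℝ≥0∞, C ≠ ∞ ∧ ∀ f : ℤ → X → ℝ≥0∞, (∀ n, Measurable (f n)) →
      ∫⁻ x, lqNorm q (fun n => f n x) ^ p ∂μ ≠ ∞ →
      ∫⁻ x, lqNorm q (fun n => avg μ (R n) (f n) x) ^ p ∂μ ≤
        C * ∫⁻ x, lqNorm q (fun n => f n x) ^ p ∂μ := by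
  have hp0 : 0 < p := by linarith
  by_cases hqt : q = ∞
  · refine ⟨maxConst c p, maxConst_ne_top h.ne_top hp, fun f hf _ => ?_⟩
    simp only [lqNorm, if_pos hqt]
    have hF : Measurable fun x => ⨆ n, f n x := Measurable.iSup hf
    refine le_trans (lintegral_mono fun x => ENNReal.rpow_le_rpow ?_ hp0.le)
      (lintegral_rpow_iSup_le (G := fun N => maxAvg μ R (symmIcc N) fun x => ⨆ n, f n x)
        (fun N => measurable_maxAvg R _ hF) ?_ hp0
        fun N => lintegral_maxAvg_rpow_le h hR (symmIcc N) hp hF)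
    · refine iSup_le fun n => ?_
      refine le_trans ?_ (le_iSup (fun N => maxAvg μ R (symmIcc N) (fun x => ⨆ n, f n x) x)
        n.natAbs)
      refine le_trans (setAvg_mono fun y => le_iSup (fun m => f m y) n)
        (le_iSup₂ (f := fun n (_ : n ∈ symmIcc _) => avg μ (R n) (fun x => ⨆ n, f n x) x) n ?_)
      simp only [symmIcc, Finset.mem_Icc]
      lia
    · intro M N hMN x
      exact biSup_mono fun n hn => symmIcc_mono hMN hn
  · have hq1 : 1 < q.toReal := by
      rwa [← ENNReal.ofReal_lt_iff_lt_toReal zero_le_one hqt, ENNReal.ofReal_one]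
    have hq0 : 0 < q.toReal := by linarith
    obtain ⟨C, hC, hCs⟩ : ∃ C : ℝ≥0∞, C ≠ ∞ ∧ ∀ (s : Finset ℤ) (f : ℤ → X → ℝ≥0∞),
        (∀ n, Measurable (f n)) → (∀ n ∈ s, ∀ x, avg μ (R n) (f n) x ≠ ∞) →
        ∫⁻ x, (∑ n ∈ s, avg μ (R n) (f n) x ^ q.toReal) ^ (p / q.toReal) ∂μ ≤
          C * ∫⁻ x, (∑ n ∈ s, f n x ^ q.toReal) ^ (p / q.toReal) ∂μ := by
      rcases le_or_gt q.toReal p with hle | hlt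
      · obtain ⟨C, hC, hCs⟩ := exists_lintegral_sum_avg_le_of_le h hR hq1.le hle
        exact ⟨C, hC, fun s f hf _ => hCs s f hf⟩
      · exact exists_lintegral_sum_avg_le_of_lt h hR hp hlt
    refine ⟨C, hC, fun f hf hfin => ?_⟩
    simp only [lqNorm, if_neg hqt, ← ENNReal.rpow_mul, one_div_mul_eq_div] at hfin ⊢
    have hfin' : ∀ n x, avg μ (R n) (f n) x ≠ ∞ := by
      intro n x hx
      have h1 := avg_rpow_le_lintegral h (hR n) hp.le (hf n) x
      rw [hx, ENNReal.top_rpow_of_pos hp0, top_le_iff] at h1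
      refine ENNReal.div_ne_top (ne_top_of_le_ne_top hfin (lintegral_mono fun y => ?_))
        (h.pos x _ (hR n)).ne' h1
      calc f n y ^ p = (f n y ^ q.toReal) ^ (p / q.toReal) := by
            rw [← ENNReal.rpow_mul, mul_div_cancel₀ _ hq0.ne']
        _ ≤ _ := by
            gcongr
            exact ENNReal.le_tsum (f := fun n => f n y ^ q.toReal) n
    have hsup : ∀ x, ∑' n, avg μ (R n) (f n) x ^ q.toReal =
        ⨆ N, ∑ n ∈ symmIcc N, avg μ (R n) (f n) x ^ q.toReal := fun x =>
      ENNReal.tsum_eq_iSup_sum' symmIcc exists_subset_symmIcc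
    simp_rw [hsup]
    refine lintegral_rpow_iSup_le
      (G := fun N x => ∑ n ∈ symmIcc N, avg μ (R n) (f n) x ^ q.toReal)
      (fun N => Finset.measurable_fun_sum _ fun n _ => (measurable_avg _ (hf n)).pow_const _)
      (fun M N hMN x => Finset.sum_le_sum_of_subset (symmIcc_mono hMN)) (by positivity)
      fun N => (hCs _ f hf fun n _ => hfin' n).trans ?_
    gcongr
    exact ENNReal.sum_le_tsum _


/-! ### The `l^q` norm and convolution with a geometric kernel -/

theorem lqNorm_mono {q : ℝ≥0∞} {a b : ℤ → ℝ≥0∞} (h : ∀ k, a k ≤ b k) :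
    lqNorm q a ≤ lqNorm q b := by
  unfold lqNorm
  split_ifs
  · exact iSup_mono h
  · gcongr
    exact h _

theorem lqNorm_const_mul {q : ℝ≥0∞} (hq : 1 ≤ q) (c : ℝ≥0∞) (a : ℤ → ℝ≥0∞) :
    lqNorm q (fun k => c * a k) = c * lqNorm q a := by
  unfold lqNorm
  split_ifs with h
  · exact (ENNReal.mul_iSup _ _).symm
  · have hq0 : 0 < q.toReal := ENNReal.toReal_pos (by positivity) h
    simp_rw [ENNReal.mul_rpow_of_nonneg _ _ hq0.le]
    rw [ENNReal.tsum_mul_left, ENNReal.mul_rpow_of_nonneg _ _ (by positivity),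
      ← ENNReal.rpow_mul, mul_one_div_cancel hq0.ne', ENNReal.rpow_one]

theorem le_lqNorm {q : ℝ≥0∞} (hq : 1 ≤ q) (a : ℤ → ℝ≥0∞) (k : ℤ) : a k ≤ lqNorm q a := by
  unfold lqNorm
  split_ifs with h
  · exact le_iSup a k
  · have hq0 : 0 < q.toReal := ENNReal.toReal_pos (by positivity) h
    calc a k = (a k ^ q.toReal) ^ (1 / q.toReal) := by
          rw [← ENNReal.rpow_mul, mul_one_div_cancel hq0.ne', ENNReal.rpow_one]
      _ ≤ _ := by
          gcongr
          exact ENNReal.le_tsum (f := fun k => a k ^ q.toReal) k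

theorem lqNorm_single_le {q : ℝ≥0∞} (hq : 1 ≤ q) (k : ℤ) (t : ℝ≥0∞) :
    lqNorm q (fun n => if n = k then t else 0) ≤ t := by
  unfold lqNorm
  split_ifs with h
  · refine iSup_le fun n => ?_
    beta_reduce
    split_ifs <;> simp
  · have hq0 : 0 < q.toReal := ENNReal.toReal_pos (by positivity) h
    rw [tsum_eq_single k fun n hn => by simp [hn, hq0]]
    beta_reduce
    rw [if_pos rfl, ← ENNReal.rpow_mul,
      mul_one_div_cancel hq0.ne', ENNReal.rpow_one]

theorem lqNorm_add_le {q : ℝ≥0∞} (hq : 1 ≤ q) (a b : ℤ → ℝ≥0∞) :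
    lqNorm q (fun k => a k + b k) ≤ 2 * (lqNorm q a + lqNorm q b) := by
  have h1 : ∀ k, a k + b k ≤ 2 * max (a k) (b k) := fun k => by
    rw [two_mul]; exact add_le_add (le_max_left _ _) (le_max_right _ _)
  refine (lqNorm_mono h1).trans ?_
  rw [lqNorm_const_mul hq]
  refine mul_le_mul' le_rfl ?_
  by_cases h : q = ∞
  · simp only [lqNorm, if_pos h]
    refine iSup_le fun k => max_le ?_ ?_
    · exact (le_iSup a k).trans le_self_add
    · exact (le_iSup b k).trans le_add_self
  · have hq0 : 0 < q.toReal := ENNReal.toReal_pos (by positivity) h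
    have hq1 : 1 ≤ q.toReal := by
      rwa [← ENNReal.ofReal_le_iff_le_toReal h, ENNReal.ofReal_one]
    simp only [lqNorm, if_neg h]
    refine le_trans ?_ (ENNReal.rpow_add_le_add_rpow _ _ (by positivity)
      ((div_le_one hq0).mpr hq1))
    rw [← ENNReal.tsum_add]
    gcongr with k
    rcases le_total (a k) (b k) with hab | hab
    · rw [max_eq_right hab]; exact le_add_self
    · rw [max_eq_left hab]; exact le_self_add

theorem measurable_lqNorm (q : ℝ≥0∞) {g : ℤ → X → ℝ≥0∞} (hg : ∀ k, Measurable (g k)) :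
    Measurable fun x => lqNorm q fun k => g k x := by
  unfold lqNorm
  split_ifs
  · exact Measurable.iSup hg
  · exact (Measurable.tsum fun k => (hg k).pow_const _).pow_const _

/-- Convolution of a sequence with the geometric kernel `2^{-ε|n|}`. -/
def geoConv (ε : ℝ) (a : ℤ → ℝ≥0∞) (k : ℤ) : ℝ≥0∞ :=
  ∑' n : ℤ, (2 : ℝ≥0∞) ^ (-ε * |(n : ℝ) - k|) * a n

theorem measurable_geoConv (ε : ℝ) {g : ℤ → X → ℝ≥0∞} (hg : ∀ k, Measurable (g k)) (k : ℤ) :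
    Measurable fun x => geoConv ε (fun n => g n x) k :=
  Measurable.tsum fun n => (hg n).const_mul _

theorem exists_lqNorm_geoConv_le {ε : ℝ} (hε : 0 < ε) {q : ℝ≥0∞} (hq : 1 ≤ q) :
    ∃ C : ℝ≥0∞, C ≠ ∞ ∧ ∀ a : ℤ → ℝ≥0∞, lqNorm q (geoConv ε a) ≤ C * lqNorm q a := by
  by_cases h : q = ∞
  · refine ⟨geo ε, geo_ne_top hε, fun a => ?_⟩
    simp only [lqNorm, if_pos h]
    refine iSup_le fun k => ?_
    rw [← tsum_geo_left ε k, ← ENNReal.tsum_mul_right]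
    exact ENNReal.tsum_le_tsum fun n => mul_le_mul' le_rfl (le_iSup a n)
  · have hq0 : 0 < q.toReal := ENNReal.toReal_pos (by positivity) h
    refine ⟨geo (ε / 2) * geo (ε / 2 * q.toReal) ^ (1 / q.toReal),
      ENNReal.mul_ne_top (geo_ne_top (by positivity)) (ENNReal.rpow_ne_top_of_nonneg
        (by positivity) (geo_ne_top (by positivity))), fun a => ?_⟩
    have h1 : ∀ k, geoConv ε a k ≤ geo (ε / 2) *
        (∑' n : ℤ, (2 : ℝ≥0∞) ^ (-(ε / 2 * q.toReal) * |(n : ℝ) - k|) * a n ^ q.toReal) ^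
          (1 / q.toReal) := by
      intro k
      rw [← tsum_geo_left (ε / 2) k, ← ENNReal.tsum_mul_right]
      refine ENNReal.tsum_le_tsum fun n => ?_
      have : -ε * |(n : ℝ) - k| = -(ε / 2) * |(n : ℝ) - k| + -(ε / 2) * |(n : ℝ) - k| := by ring
      rw [this, two_rpow_add, mul_assoc]
      refine mul_le_mul' le_rfl ?_
      calc (2 : ℝ≥0∞) ^ (-(ε / 2) * |(n : ℝ) - k|) * a n
          = ((2 : ℝ≥0∞) ^ (-(ε / 2 * q.toReal) * |(n : ℝ) - k|) * a n ^ q.toReal) ^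
              (1 / q.toReal) := by
            rw [ENNReal.mul_rpow_of_nonneg _ _ (by positivity), ← ENNReal.rpow_mul,
              ← ENNReal.rpow_mul, mul_one_div_cancel hq0.ne', ENNReal.rpow_one]
            congr 2
            field_simp
        _ ≤ _ := by
            gcongr
            exact ENNReal.le_tsum
              (f := fun n : ℤ => (2 : ℝ≥0∞) ^ (-(ε / 2 * q.toReal) * |(n : ℝ) - k|) *
                a n ^ q.toReal) n
    refine (lqNorm_mono h1).trans ?_
    rw [lqNorm_const_mul hq, mul_assoc]
    refine mul_le_mul' le_rfl (le_of_eq ?_)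
    simp only [lqNorm, if_neg h]
    rw [← ENNReal.mul_rpow_of_nonneg _ _ (by positivity)]
    simp_rw [← ENNReal.rpow_mul, one_div_mul_cancel hq0.ne', ENNReal.rpow_one]
    rw [ENNReal.tsum_comm]
    simp_rw [ENNReal.tsum_mul_right, tsum_geo_right]
    rw [ENNReal.tsum_mul_left]

theorem mixedNorm_rpow {μ : Measure X} {p : ℝ} (hp : 0 < p) (Ω : Set X) (q : ℝ≥0∞)
    (g : ℤ → X → ℝ≥0∞) :
    mixedNorm μ Ω p q g ^ p = ∫⁻ x in Ω, lqNorm q (fun k => g k x) ^ p ∂μ := by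
  rw [mixedNorm, ← ENNReal.rpow_mul, one_div_mul_cancel hp.ne', ENNReal.rpow_one]

/-! ### The potential capacity is controlled by the relative capacity -/

theorem setAvg_mono_off_null {μ : Measure X} {S N : Set X} (hS : MeasurableSet S) (hN : μ N = 0)
    {f g : X → ℝ≥0∞} (h : ∀ y ∈ S \ N, f y ≤ g y) : setAvg μ S f ≤ setAvg μ S g := by
  refine ENNReal.div_le_div_right (lintegral_mono_ae ?_) _
  filter_upwards [ae_restrict_mem hS,
    ae_restrict_of_ae (measure_eq_zero_iff_ae_notMem.mp hN)] with y hy hyN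
  exact h y ⟨hy, hyN⟩

theorem setAvg_le_setAvg_add {μ : Measure X} {S T N : Set X} (hS : MeasurableSet S)
    (hT : MeasurableSet T) (hS0 : μ S ≠ 0) (hSt : μ S ≠ ∞) (hT0 : μ T ≠ 0) (hTt : μ T ≠ ∞)
    (hN : μ N = 0) {u H : X → ℝ≥0∞} (hu : Measurable u) (hH : Measurable H) (b : ℝ≥0∞)
    (h : ∀ y ∈ S \ N, ∀ z ∈ T \ N, u y ≤ u z + b * (H y + H z)) :
    setAvg μ S u ≤ setAvg μ T u + b * (setAvg μ S H + setAvg μ T H) := by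
  have h1 : ∀ z ∈ T \ N, setAvg μ S u ≤ b * setAvg μ S H + 1 * (u z + b * H z) := by
    intro z hz
    refine (setAvg_mono_off_null (g := fun y => (u z + b * H z) + b * H y) hS hN
      fun y hy => (h y hy z hz).trans (le_of_eq (by ring))).trans (le_of_eq ?_)
    rw [setAvg_const_add_mul hS0 hSt _ _ hH]
    ring
  have h2 := setAvg_mono_off_null (f := fun _ => setAvg μ S u) hT hN h1
  rw [setAvg_const hT0 hTt, setAvg_const_add_mul (h := fun z => u z + b * H z) hT0 hTt _ _
    (hu.add (hH.const_mul b))] at h2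
  refine h2.trans (le_of_eq ?_)
  have h3 : setAvg μ T (fun z => u z + b * H z) = setAvg μ T u + b * setAvg μ T H := by
    unfold setAvg
    rw [lintegral_add_left hu, lintegral_const_mul _ hH, ENNReal.add_div, mul_div_assoc]
  rw [h3]
  ring

theorem exists_dyadic_scale {t : ℝ} (ht : 0 < t) :
    ∃ k : ℤ, (2 : ℝ) ^ (-k - 1) ≤ t ∧ t < 2 ^ (-k) := by
  obtain ⟨n, hn1, hn2⟩ := exists_mem_Ico_zpow ht one_lt_two
  exact ⟨-n - 1, by simpa using hn1, by simpa [add_comm] using hn2⟩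

theorem le_geoConv (ε : ℝ) (a : ℤ → ℝ≥0∞) (n k : ℤ) :
    a n ≤ 2 ^ (ε * |(n : ℝ) - k|) * geoConv ε a k := by
  have h1 := ENNReal.le_tsum (f := fun n : ℤ => (2 : ℝ≥0∞) ^ (-ε * |(n : ℝ) - k|) * a n) n
  calc a n = 2 ^ (ε * |(n : ℝ) - k|) * (2 ^ (-ε * |(n : ℝ) - k|) * a n) := by
        rw [← mul_assoc, ← two_rpow_add]; simp
    _ ≤ _ := mul_le_mul' le_rfl h1

theorem ofReal_rpow_le_two_rpow {t β : ℝ} (ht : 0 ≤ t) (hβ : 0 ≤ β) {k : ℤ}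
    (h : t ≤ (2 : ℝ) ^ (-k)) : ENNReal.ofReal (t ^ β) ≤ 2 ^ (-β * (k : ℝ)) := by
  rw [← ofReal_two_rpow]
  refine ENNReal.ofReal_le_ofReal ?_
  calc t ^ β ≤ ((2 : ℝ) ^ (-k)) ^ β := by gcongr
    _ = _ := by
      rw [← Real.rpow_intCast, ← Real.rpow_mul zero_le_two]
      congr 1; push_cast; ring

theorem truncation_le_add_geoConv {β : ℝ} (hβ0 : 0 < β) (hβ1 : β < 1)
    {Ω N : Set X} {φ : X → ℝ} {g : ℤ → X → ℝ≥0∞}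
    (hg : ∀ (k : ℤ), ∀ x ∈ Ω \ N, ∀ y ∈ Ω \ N,
      (2 : ℝ) ^ (-k - 1) ≤ dist x y → dist x y < (2 : ℝ) ^ (-k) →
      ENNReal.ofReal |φ x - φ y| ≤ ENNReal.ofReal (dist x y ^ β) * (g k x + g k y))
    (k : ℤ) {y z : X} (hy : y ∈ Ω \ N) (hz : z ∈ Ω \ N) (hd : dist y z < (2 : ℝ) ^ (1 - k)) :
    min (ENNReal.ofReal (φ y)) 1 ≤ min (ENNReal.ofReal (φ z)) 1 +
      4 * 2 ^ (-β * (k : ℝ)) *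
        (geoConv β (fun n => g n y) k + geoConv β (fun n => g n z) k) := by
  rcases eq_or_ne y z with rfl | hne
  · exact le_self_add
  obtain ⟨j, hj1, hj2⟩ := exists_dyadic_scale (dist_pos.mpr hne)
  have hjk : k - 1 ≤ j := by
    have := (zpow_lt_zpow_iff_right₀ (one_lt_two (α := ℝ))).mp (hj1.trans_lt hd)
    lia
  have h1 : ENNReal.ofReal (φ y) ≤ ENNReal.ofReal (φ z) + ENNReal.ofReal |φ y - φ z| :=
    (ENNReal.ofReal_le_ofReal (by linarith [le_abs_self (φ y - φ z)])).trans
      ENNReal.ofReal_add_le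
  have h2 : ENNReal.ofReal |φ y - φ z| ≤ 4 * 2 ^ (-β * (k : ℝ)) *
        (geoConv β (fun n => g n y) k + geoConv β (fun n => g n z) k) := by
    calc ENNReal.ofReal |φ y - φ z|
        ≤ ENNReal.ofReal (dist y z ^ β) * (g j y + g j z) := hg j y hy z hz hj1 hj2
      _ ≤ 2 ^ (-β * (j : ℝ)) * (2 ^ (β * |(j : ℝ) - k|) * geoConv β (fun n => g n y) k +
            2 ^ (β * |(j : ℝ) - k|) * geoConv β (fun n => g n z) k) :=
          mul_le_mul' (ofReal_rpow_le_two_rpow dist_nonneg hβ0.le hj2.le)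
            (add_le_add (le_geoConv β (fun n => g n y) j k) (le_geoConv β (fun n => g n z) j k))
      _ = 2 ^ (-β * (j : ℝ) + β * |(j : ℝ) - k|) *
            (geoConv β (fun n => g n y) k + geoConv β (fun n => g n z) k) := by
          rw [two_rpow_add]; ring
      _ ≤ _ := by
          refine mul_le_mul' ?_ le_rfl
          have h4 : (4 : ℝ≥0∞) = 2 ^ (2 : ℝ) := by norm_num
          rw [h4, ← two_rpow_add]
          refine two_rpow_mono ?_
          have hjk' : (k : ℝ) - 1 ≤ j := by exact_mod_cast hjk
          rcases abs_cases ((j : ℝ) - k) with ⟨h, _⟩ | ⟨h, _⟩ <;> rw [h] <;> nlinarith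
  calc min (ENNReal.ofReal (φ y)) 1
      ≤ min (ENNReal.ofReal (φ z) + ENNReal.ofReal |φ y - φ z|)
          (1 + ENNReal.ofReal |φ y - φ z|) := min_le_min h1 le_self_add
    _ = min (ENNReal.ofReal (φ z)) 1 + ENNReal.ofReal |φ y - φ z| := min_add_add_right _ _ _
    _ ≤ _ := by gcongr

theorem avg_succ_le {μ : Measure X} {c : ℝ≥0∞} (h : DoublingMeasure μ c) {Ω N : Set X}
    (hN : μ N = 0) {u H : X → ℝ≥0∞} (hu : Measurable u) (hH : Measurable H) (b : ℝ≥0∞) (k : ℤ)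
    {x : X} (hx : ball x ((2 : ℝ) ^ (-k)) ⊆ Ω)
    (huH : ∀ y ∈ Ω \ N, ∀ z ∈ Ω \ N, dist y z < (2 : ℝ) ^ (1 - k) →
      u y ≤ u z + b * (H y + H z)) :
    avg μ ((2 : ℝ) ^ (-(k + 1))) u x ≤
      avg μ ((2 : ℝ) ^ (-k)) u x + (1 + c) * (b * avg μ ((2 : ℝ) ^ (-k)) H x) := by
  have h2 : (2 : ℝ) ^ (-k) = 2 * 2 ^ (-(k + 1)) := by
    rw [← zpow_one_add₀ two_ne_zero]; congr 1; ring
  have h3 : (2 : ℝ) ^ (1 - k) = 2 * 2 ^ (-k) := by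
    rw [← zpow_one_add₀ two_ne_zero]; congr 1
  have hp1 : (0 : ℝ) < 2 ^ (-(k + 1)) := by positivity
  have hp2 : (0 : ℝ) < 2 ^ (-k) := by positivity
  have hsub : ball x ((2 : ℝ) ^ (-(k + 1))) ⊆ ball x (2 ^ (-k)) := ball_subset_ball (by linarith)
  have key := setAvg_le_setAvg_add measurableSet_ball measurableSet_ball
    (h.pos x _ hp1).ne' (h.fin x _) (h.pos x _ hp2).ne' (h.fin x _) hN hu hH b
    fun y hy z hz => huH y ⟨hx (hsub hy.1), hy.2⟩ z ⟨hx hz.1, hz.2⟩ (by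
      have h4 := mem_ball.mp hy.1
      have h5 := mem_ball'.mp hz.1
      have := dist_triangle y x z
      linarith)
  refine key.trans (add_le_add le_rfl ?_)
  have h6 : setAvg μ (ball x ((2 : ℝ) ^ (-(k + 1)))) H ≤
      c ^ 1 * setAvg μ (ball x ((2 : ℝ) ^ (-k))) H :=
    setAvg_le_of_subset hsub (h.inv_ball_le hp1 1 (by simp [h2])) H
  calc b * (setAvg μ (ball x ((2 : ℝ) ^ (-(k + 1)))) H + setAvg μ (ball x ((2 : ℝ) ^ (-k))) H)
      ≤ b * (c ^ 1 * setAvg μ (ball x ((2 : ℝ) ^ (-k))) H +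
          setAvg μ (ball x ((2 : ℝ) ^ (-k))) H) := by gcongr
    _ = _ := by unfold avg; ring

/-- Telescoping of averages over dyadic balls shrinking to `x`. -/
theorem avg_le_telescope {μ : Measure X} {c : ℝ≥0∞} (h : DoublingMeasure μ c) {Ω N : Set X}
    (hN : μ N = 0) {u : X → ℝ≥0∞} {H : ℤ → X → ℝ≥0∞} (hu : Measurable u)
    (hH : ∀ k, Measurable (H k)) (b : ℤ → ℝ≥0∞) (k₀ : ℤ)
    {x : X} (hx : ball x ((2 : ℝ) ^ (-k₀)) ⊆ Ω)
    (huH : ∀ k, ∀ y ∈ Ω \ N, ∀ z ∈ Ω \ N, dist y z < (2 : ℝ) ^ (1 - k) →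
      u y ≤ u z + b k * (H k y + H k z)) (m : ℕ) :
    avg μ ((2 : ℝ) ^ (-(k₀ + m))) u x ≤ avg μ ((2 : ℝ) ^ (-k₀)) u x +
      (1 + c) * ∑ i ∈ Finset.range m,
        b (k₀ + i) * avg μ ((2 : ℝ) ^ (-(k₀ + i))) (H (k₀ + i)) x := by
  induction m with
  | zero => simp
  | succ m ih =>
    have hsub : ball x ((2 : ℝ) ^ (-(k₀ + m))) ⊆ Ω :=
      (ball_subset_ball (zpow_le_zpow_right₀ one_le_two (by lia))).trans hx
    have := avg_succ_le h hN hu (hH (k₀ + m)) (b (k₀ + m)) (k₀ + m) hsub (huH _)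
    rw [Finset.sum_range_succ, mul_add, ← add_assoc]
    push_cast
    rw [← add_assoc]
    exact this.trans (add_le_add ih le_rfl)

theorem one_le_of_avg_le {μ : Measure X} {c : ℝ≥0∞} (h : DoublingMeasure μ c) {u : X → ℝ≥0∞}
    (hu : Continuous u) {x : X} (hx : u x = 1) (k₀ : ℤ) {K : ℝ≥0∞}
    (hK : ∀ m : ℕ, avg μ ((2 : ℝ) ^ (-(k₀ + m))) u x ≤ K) : 1 ≤ K := by
  refine le_of_forall_lt_imp_le_of_dense fun a ha => ?_
  rw [← hx] at ha
  obtain ⟨δ, hδ, hball⟩ := Metric.mem_nhds_iff.mp (hu.continuousAt.eventually (lt_mem_nhds ha))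
  obtain ⟨m, hm⟩ := exists_pow_lt_of_lt_one (show 0 < δ / 2 ^ (-k₀) by positivity)
    (show (1 / 2 : ℝ) < 1 by norm_num)
  have hm2 : (2 : ℝ) ^ (-(k₀ + m)) < δ := by
    rw [lt_div_iff₀ (by positivity)] at hm
    rw [neg_add, zpow_add₀ two_ne_zero, zpow_neg _ (m : ℤ), zpow_natCast]
    simpa [mul_comm] using hm
  refine le_trans ?_ (hK m)
  have hp : (0 : ℝ) < 2 ^ (-(k₀ + m)) := by positivity
  rw [avg, ← setAvg_const (h.pos x _ hp).ne' (h.fin x _) a]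
  exact setAvg_mono_off_null (N := ∅) measurableSet_ball measure_empty
    fun y hy => (hball (ball_subset_ball hm2.le hy.1)).le

theorem inv_measure_annulus_le {μ : Measure X} {c : ℝ≥0∞} (h : DoublingMeasure μ c)
    {cR : ℝ≥0∞} (hcR : cR < 1) (hrd : IsReverseDoubling μ cR) {x₀ : X} {r : ℝ} (hr : 0 < r)
    (hdiam : ENNReal.ofReal (80 * r) < EMetric.diam (univ : Set X)) {x : X} {ρ : ℝ}
    (hx : ρ + dist x x₀ ≤ 16 * r) :
    (μ (ball x₀ (4 * r) \ ball x₀ (2 * r)))⁻¹ ≤ (1 - cR)⁻¹ * c ^ 2 * (μ (ball x ρ))⁻¹ := by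
  have hlt : 2 * ENNReal.ofReal (4 * r) < EMetric.diam (univ : Set X) := by
    refine lt_of_le_of_lt ?_ hdiam
    rw [← ENNReal.ofReal_ofNat 2, ← ENNReal.ofReal_mul zero_le_two]
    exact ENNReal.ofReal_le_ofReal (by linarith)
  have h1 := hrd x₀ (4 * r) (by positivity) hlt
  rw [show 4 * r / 2 = 2 * r by ring] at h1
  have h2 : (1 - cR) * μ (ball x₀ (4 * r)) ≤ μ (ball x₀ (4 * r) \ ball x₀ (2 * r)) := by
    rw [measure_sdiff (ball_subset_ball (by linarith)) measurableSet_ball.nullMeasurableSet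
      (h.fin _ _), ENNReal.sub_mul fun _ _ => h.fin _ _, one_mul]
    exact tsub_le_tsub_left h1 _
  have h3 := ENNReal.inv_le_inv.mpr h2
  have h4 := h.inv_ball_le (x := x₀) (y := x) (r := 4 * r) (R := ρ) (by positivity) 2
    (by linarith)
  refine h3.trans ?_
  rw [ENNReal.mul_inv (Or.inl (tsub_pos_of_lt hcR).ne')
    (Or.inl (ne_top_of_le_ne_top ENNReal.one_ne_top tsub_le_self)), mul_assoc]
  gcongr

theorem avg_le_of_eq_zero_on_annulus {μ : Measure X} {c : ℝ≥0∞} (h : DoublingMeasure μ c)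
    {cR : ℝ≥0∞} (hcR : cR < 1) (hrd : IsReverseDoubling μ cR) {x₀ : X} {r : ℝ} (hr : 0 < r)
    (hdiam : ENNReal.ofReal (80 * r) < EMetric.diam (univ : Set X)) {Ω N : Set X}
    (hN : μ N = 0) {u H : X → ℝ≥0∞} (hu : Measurable u) (hH : Measurable H) (b : ℝ≥0∞)
    {k : ℤ} (hk1 : 5 * r ≤ (2 : ℝ) ^ (-k)) (hk2 : (2 : ℝ) ^ (-k) ≤ 10 * r) {x : X}
    (hxx₀ : dist x x₀ ≤ r) (hx : ball x ((2 : ℝ) ^ (-k)) ⊆ Ω)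
    (hu0 : ∀ y ∉ ball x₀ (2 * r), u y = 0)
    (huH : ∀ y ∈ Ω \ N, ∀ z ∈ Ω \ N, dist y z < (2 : ℝ) ^ (1 - k) →
      u y ≤ u z + b * (H y + H z)) :
    avg μ ((2 : ℝ) ^ (-k)) u x ≤
      (1 + (1 - cR)⁻¹ * c ^ 2) * (b * avg μ ((2 : ℝ) ^ (-k)) H x) := by
  have hp : (0 : ℝ) < 2 ^ (-k) := by positivity
  have h3 : (2 : ℝ) ^ (1 - k) = 2 * 2 ^ (-k) := by
    rw [← zpow_one_add₀ two_ne_zero]; congr 1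
  set A := ball x₀ (4 * r) \ ball x₀ (2 * r) with hA
  have hAT : A ⊆ ball x (2 ^ (-k)) := by
    intro z hz
    have h4 := mem_ball.mp hz.1
    have := dist_triangle z x₀ x
    rw [dist_comm x₀ x] at this
    exact mem_ball.mpr (by linarith)
  have hinv := inv_measure_annulus_le h hcR hrd hr hdiam (x := x) (ρ := 2 ^ (-k)) (by linarith)
  have hA0 : μ A ≠ 0 := by
    intro h0
    rw [← hA, h0, ENNReal.inv_zero, top_le_iff] at hinv
    refine ENNReal.mul_ne_top (ENNReal.mul_ne_top ?_ (ENNReal.pow_ne_top h.ne_top))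
      (ENNReal.inv_ne_top.mpr (h.pos x _ hp).ne') hinv
    exact ENNReal.inv_ne_top.mpr (tsub_pos_of_lt hcR).ne'
  have hAt : μ A ≠ ∞ := ne_top_of_le_ne_top (h.fin x _) (measure_mono hAT)
  have hAm : MeasurableSet A := measurableSet_ball.diff measurableSet_ball
  have key := setAvg_le_setAvg_add measurableSet_ball hAm (h.pos x _ hp).ne' (h.fin x _)
    hA0 hAt hN hu hH b fun y hy z hz => huH y ⟨hx hy.1, hy.2⟩ z ⟨hx (hAT hz.1), hz.2⟩ (by
      have h4 := mem_ball.mp hy.1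
      have h5 := mem_ball'.mp (hAT hz.1)
      have := dist_triangle y x z
      linarith)
  have h0 : setAvg μ A u = 0 := by
    have := setAvg_mono_off_null (f := u) (g := fun _ => 0) hAm (measure_empty (μ := μ))
      fun y hy => (hu0 y hy.1.2).le
    rw [setAvg_const hA0 hAt] at this
    exact le_bot_iff.mp this
  rw [h0, zero_add] at key
  refine key.trans ?_
  calc b * (setAvg μ (ball x ((2 : ℝ) ^ (-k))) H + setAvg μ A H)
      ≤ b * (setAvg μ (ball x ((2 : ℝ) ^ (-k))) H +
          (1 - cR)⁻¹ * c ^ 2 * setAvg μ (ball x ((2 : ℝ) ^ (-k))) H) := by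
        gcongr
        exact setAvg_le_of_subset hAT hinv H
    _ = _ := by unfold avg; ring

/-- Pointwise lower bound for the potential of a sequence built from a Hajłasz gradient. -/
theorem one_le_tsum_avg {μ : Measure X} {c : ℝ≥0∞} (h : DoublingMeasure μ c)
    {cR : ℝ≥0∞} (hcR : cR < 1) (hrd : IsReverseDoubling μ cR) {β : ℝ} (hβ0 : 0 < β)
    (hβ1 : β < 1) {Λ : ℝ} (hΛ : 41 ≤ Λ) {x₀ : X} {r : ℝ} (hr : 0 < r)
    (hdiam : ENNReal.ofReal (80 * r) < EMetric.diam (univ : Set X))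
    {φ : X → ℝ} (hφ : Continuous φ) (hφ0 : ∀ x ∉ ball x₀ (2 * r), φ x = 0)
    {g : ℤ → X → ℝ≥0∞} (hg : IsFracGrad μ β (ball x₀ (Λ * r)) φ g) {k₀ : ℤ}
    (hk1 : 5 * r ≤ (2 : ℝ) ^ (-k₀)) (hk2 : (2 : ℝ) ^ (-k₀) ≤ 10 * r) {x : X}
    (hx : dist x x₀ ≤ r) (hφx : 1 ≤ φ x) :
    1 ≤ 4 * (2 + (1 - cR)⁻¹ * c ^ 2 + c) * ∑' i : ℕ, 2 ^ (-β * ((k₀ + i : ℤ) : ℝ)) *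
      avg μ ((2 : ℝ) ^ (-(k₀ + i))) (fun y => geoConv β (fun n => g n y) (k₀ + i)) x := by
  obtain ⟨hgm, N, -, hN, hgN⟩ := hg
  set u : X → ℝ≥0∞ := fun y => min (ENNReal.ofReal (φ y)) 1
  have hu : Continuous u := (ENNReal.continuous_ofReal.comp hφ).min continuous_const
  set H : ℤ → X → ℝ≥0∞ := fun k y => geoConv β (fun n => g n y) k
  have hH : ∀ k, Measurable (H k) := fun k => measurable_geoConv β hgm k
  have hsub : ball x ((2 : ℝ) ^ (-k₀)) ⊆ ball x₀ (Λ * r) := ball_subset_ball' (by nlinarith)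
  have huH := fun k y hy z hz hd => truncation_le_add_geoConv hβ0 hβ1 hgN k (y := y) (z := z)
    hy hz hd
  set t : ℕ → ℝ≥0∞ := fun i => 2 ^ (-β * ((k₀ + i : ℤ) : ℝ)) *
    avg μ ((2 : ℝ) ^ (-(k₀ + i))) (H (k₀ + i)) x
  show 1 ≤ 4 * (2 + (1 - cR)⁻¹ * c ^ 2 + c) * ∑' i, t i
  refine one_le_of_avg_le h hu (x := x) (by simp [u, hφx]) k₀ fun m => ?_
  have h1 := avg_le_telescope h hN hu.measurable hH
    (fun k => 4 * 2 ^ (-β * (k : ℝ))) k₀ hsub huH m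
  have h2 := avg_le_of_eq_zero_on_annulus h hcR hrd hr hdiam hN hu.measurable (hH k₀)
    (4 * 2 ^ (-β * (k₀ : ℝ))) hk1 hk2 hx hsub (fun y hy => by simp [u, hφ0 y hy]) (huH k₀)
  have h3 : (2 : ℝ≥0∞) ^ (-β * (k₀ : ℝ)) * avg μ ((2 : ℝ) ^ (-k₀)) (H k₀) x ≤ ∑' i, t i := by
    simpa [t] using ENNReal.le_tsum (f := t) 0
  calc avg μ ((2 : ℝ) ^ (-(k₀ + m))) u x
      ≤ (1 + (1 - cR)⁻¹ * c ^ 2) *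
          (4 * (2 ^ (-β * (k₀ : ℝ)) * avg μ ((2 : ℝ) ^ (-k₀)) (H k₀) x)) +
        (1 + c) * (4 * ∑ i ∈ Finset.range m, t i) := by
        refine h1.trans (add_le_add (h2.trans (le_of_eq (by ring))) (le_of_eq ?_))
        rw [Finset.mul_sum, Finset.mul_sum, Finset.mul_sum]
        exact Finset.sum_congr rfl fun i _ => by simp only [t]; ring
    _ ≤ (1 + (1 - cR)⁻¹ * c ^ 2) * (4 * ∑' i, t i) + (1 + c) * (4 * ∑' i, t i) := by
        gcongr
        exact ENNReal.sum_le_tsum _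
    _ = _ := by ring

theorem validIdx_of_le {r : ℝ}
    (hdiam : ENNReal.ofReal (80 * r) < EMetric.diam (univ : Set X)) {n : ℤ}
    (hn : (2 : ℝ) ^ (-n) ≤ 80 * r) : validIdx X n := by
  unfold validIdx
  calc ENNReal.ofReal ((2 : ℝ) ^ (-n)) ≤ ENNReal.ofReal (80 * r) := ENNReal.ofReal_le_ofReal hn
    _ ≤ 1 * EMetric.diam (univ : Set X) := by rw [one_mul]; exact hdiam.le
    _ ≤ _ := by gcongr; exact one_le_two

theorem avg_le_mul_lintegral_indicator {μ : Measure X} {c : ℝ≥0∞} (h : DoublingMeasure μ c)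
    {H : X → ℝ≥0∞} {R : ℝ} (hR : 0 < R) (x : X) :
    avg μ R H x ≤ ∫⁻ y, (ball y R).indicator (fun _ => (1 : ℝ≥0∞)) x *
      (ball x R).indicator (fun y => c * H y) y / μ (ball y R) ∂μ := by
  have h1 : ∀ y, (ball x R).indicator (fun y => H y * (μ (ball x R))⁻¹) y ≤
      (ball y R).indicator (fun _ => (1 : ℝ≥0∞)) x *
      (ball x R).indicator (fun y => c * H y) y / μ (ball y R) := by
    intro y
    by_cases hy : y ∈ ball x R
    · rw [indicator_of_mem hy, indicator_of_mem hy, indicator_of_mem (mem_ball_comm.mp hy),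
        one_mul, div_eq_mul_inv]
      have := h.inv_ball_le (x := x) (y := y) (r := R) (R := R) hR 1
        (by linarith [mem_ball.mp hy])
      calc H y * (μ (ball x R))⁻¹ ≤ H y * (c ^ 1 * (μ (ball y R))⁻¹) := mul_le_mul' le_rfl this
        _ = _ := by ring
    · simp [indicator_of_notMem hy]
  refine le_trans ?_ (lintegral_mono h1)
  rw [lintegral_indicator measurableSet_ball, lintegral_mul_const', avg, setAvg, div_eq_mul_inv]
  exact ENNReal.inv_ne_top.mpr (h.pos x R hR).ne'

theorem exists_CpCap_le {μ : Measure X} {c : ℝ≥0∞} (h : DoublingMeasure μ c)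
    {cR : ℝ≥0∞} (hcR : cR < 1) (hrd : IsReverseDoubling μ cR) {β p Λ : ℝ} {q : ℝ≥0∞}
    (hp : 1 < p) (hq : 1 < q) (hβ0 : 0 < β) (hβ1 : β < 1) (hΛ : 41 ≤ Λ) :
    ∃ C : ℝ≥0∞, C ≠ ∞ ∧ ∀ (x₀ : X) (r : ℝ), 0 < r →
      ENNReal.ofReal (80 * r) < EMetric.diam (univ : Set X) →
      ∀ E : Set X, E ⊆ closure (ball x₀ r) →
        ∀ D : ℝ≥0∞, D ≠ ∞ → 1 ≤ D → C ≤ D →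
          D⁻¹ * CpCap μ β p q E ≤ relCap μ β p q E x₀ r Λ := by
  have hp0 : 0 < p := by linarith
  obtain ⟨Cg, hCg, hgeo⟩ := exists_lqNorm_geoConv_le hβ0 hq.le
  set K : ℝ≥0∞ := 4 * (2 + (1 - cR)⁻¹ * c ^ 2 + c) with hK
  have hKt : K ≠ ∞ := by
    have h1 : (1 - cR)⁻¹ ≠ ∞ := ENNReal.inv_ne_top.mpr (tsub_pos_of_lt hcR).ne'
    have h2 : c ^ 2 ≠ ∞ := ENNReal.pow_ne_top h.ne_top
    have h3 := h.ne_top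
    finiteness
  refine ⟨(c * K * Cg) ^ p, ENNReal.rpow_ne_top_of_nonneg hp0.le
    (ENNReal.mul_ne_top (ENNReal.mul_ne_top h.ne_top hKt) hCg),
    fun x₀ r hr hdiam E hE D hDt hD1 hD => ?_⟩
  obtain ⟨n, hn1, hn2⟩ := exists_mem_Ico_zpow (show 0 < 5 * r by positivity) one_lt_two
  set k₀ : ℤ := -(n + 1) with hk₀
  have hk1 : 5 * r ≤ (2 : ℝ) ^ (-k₀) := by rw [hk₀, neg_neg]; exact hn2.le
  have hk2 : (2 : ℝ) ^ (-k₀) ≤ 10 * r := by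
    rw [hk₀, neg_neg, zpow_add_one₀ two_ne_zero]; linarith
  refine le_iInf fun ⟨φ, hφ, hφ1, hφ0⟩ => ?_
  have hmap := (ENNReal.orderIsoRpow p hp0).map_iInf
    fun g : {g : ℤ → X → ℝ≥0∞ // IsFracGrad μ β (ball x₀ (Λ * r)) φ g} =>
      mixedNorm μ (ball x₀ (Λ * r)) p q g.1
  simp only [ENNReal.orderIsoRpow_apply] at hmap
  show _ ≤ htlSeminorm μ β p q (ball x₀ (Λ * r)) φ ^ p
  rw [htlSeminorm, hmap]
  refine le_iInf fun ⟨g, hg⟩ => ?_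
  show _ ≤ mixedNorm μ (ball x₀ (Λ * r)) p q g ^ p
  rw [ENNReal.inv_mul_le_iff (one_pos.trans_le hD1).ne' hDt]
  set Ω := ball x₀ (Λ * r) with hΩ
  set H : ℤ → X → ℝ≥0∞ := fun k y => geoConv β (fun n => g n y) k with hHdef
  have hH : ∀ k, Measurable (H k) := fun k => measurable_geoConv β hg.1 k
  set f : ℤ → X → ℝ≥0∞ := fun n y =>
    if k₀ ≤ n then Ω.indicator (fun y => c * (K * H n y)) y else 0 with hf
  have hvalid : ∀ n, k₀ ≤ n → validIdx X n := fun n hn => validIdx_of_le hdiam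
    ((zpow_le_zpow_right₀ one_le_two (by lia)).trans (hk2.trans (by linarith)))
  have hfadm : IsAdmissibleSeq f := by
    refine ⟨fun n => ?_, fun n hn => ?_⟩
    · by_cases hn : k₀ ≤ n
      · simp only [hf, if_pos hn]
        exact (((hH n).const_mul K).const_mul c).indicator measurableSet_ball
      · simp only [hf, if_neg hn]; exact measurable_const
    · ext y; simp [hf, mt (hvalid n) hn]
  have hfE : ∀ x ∈ E, 1 ≤ Hpot μ β f x := by
    intro x hx
    have hxx₀ : dist x x₀ ≤ r := closure_ball_subset_closedBall (hE hx)
    refine (one_le_tsum_avg h hcR hrd hβ0 hβ1 hΛ hr hdiam hφ hφ0 hg hk1 hk2 hxx₀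
      (hφ1 x hx)).trans ?_
    rw [← hK, ← ENNReal.tsum_mul_left, Hpot]
    refine le_trans (ENNReal.tsum_le_tsum fun i => ?_) (ENNReal.tsum_comp_le_tsum_of_injective
      (f := fun i : ℕ => k₀ + (i : ℤ)) (fun i j hij => by simpa using hij) _)
    have hki : k₀ ≤ k₀ + (i : ℤ) := by lia
    rw [if_pos (hvalid _ hki), mul_left_comm]
    refine mul_le_mul' le_rfl ?_
    have hsub : ball x ((2 : ℝ) ^ (-(k₀ + i))) ⊆ Ω := by
      have : (2 : ℝ) ^ (-(k₀ + i)) ≤ 2 ^ (-k₀) := zpow_le_zpow_right₀ one_le_two (by lia)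
      exact ball_subset_ball' (by nlinarith)
    have h1 : K * avg μ ((2 : ℝ) ^ (-(k₀ + i))) (H (k₀ + i)) x =
        avg μ ((2 : ℝ) ^ (-(k₀ + i))) (fun y => K * H (k₀ + i) y) x := by
      simp only [avg, setAvg]
      rw [lintegral_const_mul _ (hH _), mul_div_assoc]
    refine h1.le.trans ((avg_le_mul_lintegral_indicator h (by positivity) x).trans
      (lintegral_mono fun y => ?_))
    simp only [hf, if_pos hki]
    refine ENNReal.div_le_div_right (mul_le_mul' le_rfl ?_) _
    exact indicator_le_indicator_of_subset hsub (fun _ => bot_le) y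
  refine (iInf_le _ ⟨f, hfadm, hfE⟩).trans ?_
  show mixedNorm μ univ p q f ^ p ≤ _
  rw [mixedNorm_rpow hp0, mixedNorm_rpow hp0, Measure.restrict_univ]
  have hlq : ∀ y, lqNorm q (fun n => f n y) ^ p ≤
      Ω.indicator (fun y => (c * K * Cg) ^ p * lqNorm q (fun n => g n y) ^ p) y := by
    intro y
    by_cases hy : y ∈ Ω
    · rw [indicator_of_mem hy, ← ENNReal.mul_rpow_of_nonneg _ _ hp0.le]
      refine ENNReal.rpow_le_rpow ?_ hp0.le
      calc lqNorm q (fun n => f n y)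
          ≤ lqNorm q (fun n => c * K * geoConv β (fun n => g n y) n) := by
            refine lqNorm_mono fun n => ?_
            simp only [hf, indicator_of_mem hy]
            split_ifs
            · exact (mul_assoc _ _ _).ge
            · exact bot_le
        _ ≤ _ := by
            rw [lqNorm_const_mul hq.le, mul_assoc (c * K)]
            exact mul_le_mul' le_rfl (hgeo _)
    · have : (fun n => f n y) = fun _ => 0 * 0 := by
        ext n; simp [hf, indicator_of_notMem hy]
      rw [this, lqNorm_const_mul hq.le, zero_mul, ENNReal.zero_rpow_of_pos hp0]
      exact bot_le
  refine (lintegral_mono hlq).trans ?_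
  rw [lintegral_indicator measurableSet_ball,
    lintegral_const_mul _ ((measurable_lqNorm q hg.1).pow_const p)]
  exact mul_le_mul' hD le_rfl

/-! ### The relative capacity is controlled by the potential capacity -/

/-- A Lipschitz cutoff equal to `1` on `(-∞, 1]` and to `0` on `[2, ∞)`. -/
def bump (s : ℝ) : ℝ≥0∞ := ENNReal.ofReal (min 1 (2 - s))

theorem continuous_bump : Continuous bump :=
  ENNReal.continuous_ofReal.comp (by fun_prop)

theorem bump_le_one (s : ℝ) : bump s ≤ 1 := by
  rw [bump, ← ENNReal.ofReal_one]
  exact ENNReal.ofReal_le_ofReal (min_le_left _ _)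

theorem bump_eq_one {s : ℝ} (hs : s ≤ 1) : bump s = 1 := by
  rw [bump, min_eq_left (by linarith), ENNReal.ofReal_one]

theorem bump_eq_zero {s : ℝ} (hs : 2 ≤ s) : bump s = 0 :=
  ENNReal.ofReal_of_nonpos ((min_le_right _ _).trans (by linarith))

theorem bump_le_add (s t : ℝ) : bump s ≤ bump t + ENNReal.ofReal |s - t| := by
  refine le_trans (ENNReal.ofReal_le_ofReal ?_) ENNReal.ofReal_add_le
  rw [min_add]
  refine min_le_min ?_ ?_
  · linarith [abs_nonneg (s - t)]
  · linarith [neg_abs_le (s - t)]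

theorem bump_le_add_dist {t : ℝ} (ht : 0 ≤ t) (a b y : X) :
    bump (t * dist a y) ≤ bump (t * dist b y) + ENNReal.ofReal (t * dist a b) := by
  refine (bump_le_add _ _).trans (add_le_add le_rfl (ENNReal.ofReal_le_ofReal ?_))
  rw [← mul_sub, abs_mul, abs_of_nonneg ht]
  gcongr
  exact abs_dist_sub_le a b y

/-- A term of the potential with the indicator replaced by a Lipschitz cutoff. -/
def smoothPot (μ : Measure X) (β : ℝ) (f : X → ℝ≥0∞) (n : ℤ) (x : X) : ℝ≥0∞ :=
  2 ^ (-β * (n : ℝ)) *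
    ∫⁻ y, bump ((2 : ℝ) ^ n * dist x y) * (f y / μ (ball y ((2 : ℝ) ^ (-n)))) ∂μ

theorem setLIntegral_ball_le_avg {μ : Measure X} {c : ℝ≥0∞} (h : DoublingMeasure μ c)
    (f : X → ℝ≥0∞) (n : ℤ) {a x : X} (hax : dist a x ≤ 2 * (2 : ℝ) ^ (-n)) :
    ∫⁻ y in ball a (2 * (2 : ℝ) ^ (-n)), f y / μ (ball y ((2 : ℝ) ^ (-n))) ∂μ ≤
      c ^ 3 * avg μ ((2 : ℝ) ^ (2 - n)) f x := by
  have hp : (0 : ℝ) < 2 ^ (-n) := by positivity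
  have h4 : (2 : ℝ) ^ (2 - n) = 4 * 2 ^ (-n) := by
    rw [sub_eq_add_neg, zpow_add₀ two_ne_zero]; norm_num
  rw [h4]
  have hsub : ball a (2 * (2 : ℝ) ^ (-n)) ⊆ ball x (4 * 2 ^ (-n)) :=
    ball_subset_ball' (by linarith)
  calc ∫⁻ y in ball a (2 * (2 : ℝ) ^ (-n)), f y / μ (ball y ((2 : ℝ) ^ (-n))) ∂μ
      ≤ ∫⁻ y in ball x (4 * 2 ^ (-n)), f y / μ (ball y ((2 : ℝ) ^ (-n))) ∂μ :=
        lintegral_mono_set hsub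
    _ ≤ ∫⁻ y in ball x (4 * 2 ^ (-n)), f y * (c ^ 3 * (μ (ball x (4 * 2 ^ (-n))))⁻¹) ∂μ := by
        refine setLIntegral_mono' measurableSet_ball fun y hy => ?_
        rw [div_eq_mul_inv]
        refine mul_le_mul' le_rfl (h.inv_ball_le hp 3 ?_)
        linarith [mem_ball'.mp hy]
    _ = _ := by
        rw [lintegral_mul_const', avg, setAvg, div_eq_mul_inv]
        · ring
        · exact ENNReal.mul_ne_top (ENNReal.pow_ne_top h.ne_top)
            (ENNReal.inv_ne_top.mpr (h.pos x _ (by positivity)).ne')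

theorem two_le_zpow_mul {n : ℤ} {t : ℝ} (h : 2 * (2 : ℝ) ^ (-n) ≤ t) : 2 ≤ (2 : ℝ) ^ n * t := by
  calc (2 : ℝ) = 2 ^ n * (2 * (2 : ℝ) ^ (-n)) := by
        rw [mul_left_comm, ← zpow_add₀ two_ne_zero]; simp
    _ ≤ _ := by gcongr

theorem smoothPot_le {μ : Measure X} {c : ℝ≥0∞} (h : DoublingMeasure μ c) (β : ℝ)
    (f : X → ℝ≥0∞) (n : ℤ) (x : X) :
    smoothPot μ β f n x ≤ c ^ 3 * (2 ^ (-β * (n : ℝ)) * avg μ ((2 : ℝ) ^ (2 - n)) f x) := by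
  rw [mul_left_comm, smoothPot]
  refine mul_le_mul' le_rfl (le_trans ?_ (setLIntegral_ball_le_avg h f n (a := x) (x := x)
    (by simp; positivity)))
  rw [← lintegral_indicator measurableSet_ball]
  refine lintegral_mono fun y => ?_
  by_cases hy : y ∈ ball x (2 * (2 : ℝ) ^ (-n))
  · rw [indicator_of_mem hy]
    exact (mul_le_mul' (bump_le_one _) le_rfl).trans (one_mul _).le
  · rw [bump_eq_zero (two_le_zpow_mul (by simpa [dist_comm] using hy)), zero_mul]
    exact bot_le

theorem smoothPot_le_add [SecondCountableTopology X] {μ : Measure X} [SFinite μ]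
    {c : ℝ≥0∞} (h : DoublingMeasure μ c) (β : ℝ)
    {f : X → ℝ≥0∞} (hf : Measurable f) (n : ℤ) {a x : X} (b : X)
    (hax : dist a x ≤ 2 * (2 : ℝ) ^ (-n)) :
    smoothPot μ β f n a ≤ smoothPot μ β f n b +
      c ^ 3 * (2 ^ (-β * (n : ℝ)) * ENNReal.ofReal ((2 : ℝ) ^ n * dist a b)) *
        avg μ ((2 : ℝ) ^ (2 - n)) f x := by
  set F : X → ℝ≥0∞ := fun y => f y / μ (ball y ((2 : ℝ) ^ (-n))) with hF
  have hFm : Measurable F := hf.div (measurable_measure_ball _)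
  have h1 : ∀ y, bump ((2 : ℝ) ^ n * dist a y) * F y ≤ bump ((2 : ℝ) ^ n * dist b y) * F y +
      ENNReal.ofReal ((2 : ℝ) ^ n * dist a b) * (ball a (2 * (2 : ℝ) ^ (-n))).indicator F y := by
    intro y
    by_cases hy : y ∈ ball a (2 * (2 : ℝ) ^ (-n))
    · rw [indicator_of_mem hy, ← add_mul]
      exact mul_le_mul' (bump_le_add_dist (by positivity) _ _ _) le_rfl
    · rw [bump_eq_zero (two_le_zpow_mul (by simpa [dist_comm] using hy)), zero_mul]
      exact bot_le
  have hm : Measurable fun y => bump ((2 : ℝ) ^ n * dist b y) * F y :=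
    (continuous_bump.comp (by fun_prop)).measurable.mul hFm
  calc smoothPot μ β f n a
      ≤ 2 ^ (-β * (n : ℝ)) * ∫⁻ y, (bump ((2 : ℝ) ^ n * dist b y) * F y +
          ENNReal.ofReal ((2 : ℝ) ^ n * dist a b) *
            (ball a (2 * (2 : ℝ) ^ (-n))).indicator F y) ∂μ :=
        mul_le_mul' le_rfl (lintegral_mono h1)
    _ = smoothPot μ β f n b + 2 ^ (-β * (n : ℝ)) * (ENNReal.ofReal ((2 : ℝ) ^ n * dist a b) *
          ∫⁻ y in ball a (2 * (2 : ℝ) ^ (-n)), F y ∂μ) := by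
        rw [lintegral_add_left hm, lintegral_const_mul' _ _ ENNReal.ofReal_ne_top,
          lintegral_indicator measurableSet_ball, mul_add]
        rfl
    _ ≤ smoothPot μ β f n b + 2 ^ (-β * (n : ℝ)) * (ENNReal.ofReal ((2 : ℝ) ^ n * dist a b) *
          (c ^ 3 * avg μ ((2 : ℝ) ^ (2 - n)) f x)) := by
        gcongr
        exact setLIntegral_ball_le_avg h f n hax
    _ = _ := by ring

theorem ofReal_abs_toReal_sub_le {a b D : ℝ≥0∞} (ha : a ≠ ∞) (hb : b ≠ ∞) (hab : a ≤ b + D)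
    (hba : b ≤ a + D) : ENNReal.ofReal |a.toReal - b.toReal| ≤ D := by
  rcases eq_or_ne D ∞ with rfl | hD
  · exact le_top
  refine ENNReal.ofReal_le_of_le_toReal (abs_sub_le_iff.mpr ⟨?_, ?_⟩)
  · have := ENNReal.toReal_mono (ENNReal.add_ne_top.mpr ⟨hb, hD⟩) hab
    rw [ENNReal.toReal_add hb hD] at this
    linarith
  · have := ENNReal.toReal_mono (ENNReal.add_ne_top.mpr ⟨ha, hD⟩) hba
    rw [ENNReal.toReal_add ha hD] at this
    linarith

theorem smoothPot_ne_top {μ : Measure X} {c : ℝ≥0∞} (h : DoublingMeasure μ c) (β : ℝ)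
    {f : X → ℝ≥0∞} {n : ℤ} {x : X} (hA : avg μ ((2 : ℝ) ^ (2 - n)) f x ≠ ∞) :
    smoothPot μ β f n x ≠ ∞ :=
  ne_top_of_le_ne_top (ENNReal.mul_ne_top (ENNReal.pow_ne_top h.ne_top)
    (ENNReal.mul_ne_top (two_rpow_ne_top _) hA)) (smoothPot_le h β f n x)

theorem continuous_smoothPot_toReal [SecondCountableTopology X] {μ : Measure X} [SFinite μ]
    {c : ℝ≥0∞} (h : DoublingMeasure μ c) (β : ℝ) {f : X → ℝ≥0∞} (hf : Measurable f) (n : ℤ)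
    (hA : ∀ x, avg μ ((2 : ℝ) ^ (2 - n)) f x ≠ ∞) :
    Continuous fun x => (smoothPot μ β f n x).toReal := by
  refine continuous_iff_continuousAt.mpr fun x => ?_
  set L := c ^ 3 * 2 ^ (-β * (n : ℝ)) * ENNReal.ofReal ((2 : ℝ) ^ n) *
    avg μ ((2 : ℝ) ^ (2 - n)) f x with hL
  have hLt : L ≠ ∞ := ENNReal.mul_ne_top (ENNReal.mul_ne_top (ENNReal.mul_ne_top
    (ENNReal.pow_ne_top h.ne_top) (two_rpow_ne_top _)) ENNReal.ofReal_ne_top) (hA x)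
  have key : ∀ a b, dist a x ≤ 2 * (2 : ℝ) ^ (-n) →
      smoothPot μ β f n a ≤ smoothPot μ β f n b + L * ENNReal.ofReal (dist a b) := by
    intro a b hax
    refine (smoothPot_le_add h β hf n b hax).trans (le_of_eq ?_)
    rw [ENNReal.ofReal_mul (by positivity), hL]
    ring
  refine continuousAt_of_locally_lipschitz (r := 2 * (2 : ℝ) ^ (-n)) (by positivity) L.toReal
    fun y hy => ?_
  have := ofReal_abs_toReal_sub_le (smoothPot_ne_top h β (hA y)) (smoothPot_ne_top h β (hA x))
    (key y x hy.le) (by rw [dist_comm]; exact key x y (by simp; positivity))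
  rw [ENNReal.ofReal_le_iff_le_toReal (ENNReal.mul_ne_top hLt ENNReal.ofReal_ne_top),
    ENNReal.toReal_mul, ENNReal.toReal_ofReal dist_nonneg] at this
  exact this

theorem two_rpow_mul_min_le {β ε : ℝ} (hβ0 : 0 < β) (hβ1 : β < 1) (hε : ε ≤ β)
    (hε' : ε ≤ 1 - β) (n : ℤ) {k : ℤ} {d : ℝ} (hd1 : (2 : ℝ) ^ (-k - 1) ≤ d)
    (hd2 : d < (2 : ℝ) ^ (-k)) :
    (2 : ℝ≥0∞) ^ (-β * (n : ℝ)) * min 1 (ENNReal.ofReal ((2 : ℝ) ^ n * d)) ≤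
      2 * ENNReal.ofReal (d ^ β) * 2 ^ (-ε * |(n : ℝ) - k|) := by
  have hd0 : 0 < d := lt_of_lt_of_le (by positivity) hd1
  rcases le_or_gt n k with hnk | hnk
  · have hnk' : (n : ℝ) ≤ k := by exact_mod_cast hnk
    have h1 : ENNReal.ofReal ((2 : ℝ) ^ n * d) ≤
        2 ^ (n : ℝ) * (2 ^ (-(1 - β) * (k : ℝ)) * ENNReal.ofReal (d ^ β)) := by
      rw [ENNReal.ofReal_mul (by positivity), ofReal_two_zpow]
      refine mul_le_mul' le_rfl ?_
      have : d = d ^ (1 - β) * d ^ β := by rw [← Real.rpow_add hd0]; simp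
      nth_rw 1 [this]
      rw [ENNReal.ofReal_mul (by positivity)]
      exact mul_le_mul' (ofReal_rpow_le_two_rpow hd0.le (by linarith) hd2.le) le_rfl
    calc (2 : ℝ≥0∞) ^ (-β * (n : ℝ)) * min 1 (ENNReal.ofReal ((2 : ℝ) ^ n * d))
        ≤ 2 ^ (-β * (n : ℝ)) *
            (2 ^ (n : ℝ) * (2 ^ (-(1 - β) * (k : ℝ)) * ENNReal.ofReal (d ^ β))) :=
          mul_le_mul' le_rfl ((min_le_right _ _).trans h1)
      _ = 1 * ENNReal.ofReal (d ^ β) * 2 ^ (-β * (n : ℝ) + n + -(1 - β) * (k : ℝ)) := by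
          rw [two_rpow_add, two_rpow_add]; ring
      _ ≤ _ := by
          refine mul_le_mul' (mul_le_mul' one_le_two le_rfl) (two_rpow_mono ?_)
          rw [abs_of_nonpos (by linarith)]
          nlinarith
  · have hnk' : (k : ℝ) ≤ n := by exact_mod_cast hnk.le
    have h1 : (2 : ℝ≥0∞) ^ (-β * (k + 1 : ℝ)) ≤ ENNReal.ofReal (d ^ β) := by
      rw [← ofReal_two_rpow]
      refine ENNReal.ofReal_le_ofReal ?_
      calc (2 : ℝ) ^ (-β * (k + 1 : ℝ)) = ((2 : ℝ) ^ (-k - 1)) ^ β := by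
            rw [← Real.rpow_intCast, ← Real.rpow_mul zero_le_two]
            congr 1; push_cast; ring
        _ ≤ d ^ β := by gcongr
    calc (2 : ℝ≥0∞) ^ (-β * (n : ℝ)) * min 1 (ENNReal.ofReal ((2 : ℝ) ^ n * d))
        ≤ 2 ^ (-β * (n : ℝ)) * 1 := mul_le_mul' le_rfl (min_le_left _ _)
      _ = 2 ^ β * 2 ^ (-β * (k + 1 : ℝ)) * 2 ^ (-β * (n - k : ℝ)) := by
          rw [mul_one, ← two_rpow_add, ← two_rpow_add]; congr 1; ring
      _ ≤ _ := by
          refine mul_le_mul' (mul_le_mul' ?_ h1) (two_rpow_mono ?_)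
          · calc (2 : ℝ≥0∞) ^ β ≤ 2 ^ (1 : ℝ) := two_rpow_mono hβ1.le
              _ = 2 := ENNReal.rpow_one 2
          · rw [abs_of_nonneg (by linarith)]
            nlinarith

theorem smoothPot_le_add_dyadic [SecondCountableTopology X] {μ : Measure X} [SFinite μ]
    {c : ℝ≥0∞} (h : DoublingMeasure μ c) {β ε : ℝ} (hβ0 : 0 < β) (hβ1 : β < 1) (hε : ε ≤ β)
    (hε' : ε ≤ 1 - β) {f : X → ℝ≥0∞} (hf : Measurable f) (n : ℤ) {k : ℤ} {x y : X}
    (hd1 : (2 : ℝ) ^ (-k - 1) ≤ dist x y) (hd2 : dist x y < (2 : ℝ) ^ (-k)) :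
    smoothPot μ β f n x ≤ smoothPot μ β f n y + 2 * c ^ 3 * ENNReal.ofReal (dist x y ^ β) *
      (2 ^ (-ε * |(n : ℝ) - k|) * avg μ ((2 : ℝ) ^ (2 - n)) f x) := by
  have h1 : smoothPot μ β f n x ≤ smoothPot μ β f n y +
      c ^ 3 * (2 ^ (-β * (n : ℝ)) * min 1 (ENNReal.ofReal ((2 : ℝ) ^ n * dist x y))) *
        avg μ ((2 : ℝ) ^ (2 - n)) f x := by
    rcases min_choice 1 (ENNReal.ofReal ((2 : ℝ) ^ n * dist x y)) with hm | hm <;> rw [hm]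
    · refine (smoothPot_le h β f n x).trans (le_of_eq_of_le ?_ le_add_self)
      ring
    · exact smoothPot_le_add h β hf n y (by simp; positivity)
  refine h1.trans (add_le_add le_rfl ?_)
  calc c ^ 3 * (2 ^ (-β * (n : ℝ)) * min 1 (ENNReal.ofReal ((2 : ℝ) ^ n * dist x y))) *
        avg μ ((2 : ℝ) ^ (2 - n)) f x
      ≤ c ^ 3 * (2 * ENNReal.ofReal (dist x y ^ β) * 2 ^ (-ε * |(n : ℝ) - k|)) *
        avg μ ((2 : ℝ) ^ (2 - n)) f x := by
        refine mul_le_mul' (mul_le_mul' le_rfl ?_) le_rfl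
        exact two_rpow_mul_min_le hβ0 hβ1 hε hε' n hd1 hd2
    _ = _ := by ring

theorem bump_inv_mul_dist_le_add_dyadic {β ε : ℝ} (hβ0 : 0 < β) (hβ1 : β < 1) (hε : ε ≤ β)
    (hε' : ε ≤ 1 - β) {r : ℝ} (hr : 0 < r) {m : ℤ} (hm : (2 : ℝ) ^ (-m - 1) ≤ r) {k : ℤ}
    {x y : X} (x₀ : X)
    (hd1 : (2 : ℝ) ^ (-k - 1) ≤ dist x y) (hd2 : dist x y < (2 : ℝ) ^ (-k)) :
    bump (r⁻¹ * dist x x₀) ≤ bump (r⁻¹ * dist y x₀) + 4 * ENNReal.ofReal (dist x y ^ β) *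
      (2 ^ (-ε * |(m : ℝ) - k|) * 2 ^ (β * (m : ℝ))) := by
  have h1 : ENNReal.ofReal (r⁻¹ * dist x y) ≤ 2 * ENNReal.ofReal ((2 : ℝ) ^ m * dist x y) := by
    rw [← ENNReal.ofReal_ofNat 2, ← ENNReal.ofReal_mul zero_le_two, ← mul_assoc]
    refine ENNReal.ofReal_le_ofReal (mul_le_mul_of_nonneg_right ?_ dist_nonneg)
    rw [inv_le_comm₀ hr (by positivity), mul_inv, ← zpow_neg]
    refine le_of_eq_of_le ?_ hm
    rw [zpow_sub_one₀ two_ne_zero, mul_comm]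
  have h2 : bump (r⁻¹ * dist x x₀) ≤ bump (r⁻¹ * dist y x₀) +
      2 * min 1 (ENNReal.ofReal ((2 : ℝ) ^ m * dist x y)) := by
    rcases min_choice 1 (ENNReal.ofReal ((2 : ℝ) ^ m * dist x y)) with hmin | hmin <;> rw [hmin]
    · exact (bump_le_one _).trans (le_add_left (by norm_num))
    · exact (bump_le_add_dist (by positivity) _ _ _).trans (add_le_add le_rfl h1)
  refine h2.trans (add_le_add le_rfl ?_)
  calc 2 * min 1 (ENNReal.ofReal ((2 : ℝ) ^ m * dist x y))
      = 2 * 2 ^ (β * (m : ℝ)) *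
          (2 ^ (-β * (m : ℝ)) * min 1 (ENNReal.ofReal ((2 : ℝ) ^ m * dist x y))) := by
        rw [mul_assoc, ← mul_assoc (2 ^ (β * (m : ℝ))), ← two_rpow_add]; simp
    _ ≤ 2 * 2 ^ (β * (m : ℝ)) *
          (2 * ENNReal.ofReal (dist x y ^ β) * 2 ^ (-ε * |(m : ℝ) - k|)) := by
        refine mul_le_mul' le_rfl (two_rpow_mul_min_le hβ0 hβ1 hε hε' m hd1 hd2)
    _ = _ := by ring

theorem geoConv_add_single (ε : ℝ) (a : ℤ → ℝ≥0∞) (t : ℝ≥0∞) (m k : ℤ) :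
    geoConv ε (fun n => a n + if n = m then t else 0) k =
      geoConv ε a k + 2 ^ (-ε * |(m : ℝ) - k|) * t := by
  simp only [geoConv, mul_add, ENNReal.tsum_add]
  congr 1
  rw [tsum_eq_single m fun n hn => by simp [hn]]
  simp

/-- The averages controlling the oscillation of the smoothed potential. -/
def gradAvg (μ : Measure X) (f : ℤ → X → ℝ≥0∞) (n : ℤ) (x : X) : ℝ≥0∞ :=
  avg μ ((2 : ℝ) ^ (2 - n)) (f n) x

/-- The averages `gradAvg` together with the contribution of the cutoff at scale `2^{-m}`. -/
def gradSeq (μ : Measure X) (β : ℝ) (m : ℤ) (f : ℤ → X → ℝ≥0∞) (n : ℤ) (x : X) : ℝ≥0∞ :=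
  gradAvg μ f n x + if n = m then 2 ^ (β * (m : ℝ)) *
    ∑' j : ℤ, 2 ^ (-β * (j : ℝ)) * gradAvg μ f j x else 0

theorem measurable_gradAvg [SecondCountableTopology X] {μ : Measure X} [SFinite μ]
    {f : ℤ → X → ℝ≥0∞} (hf : ∀ n, Measurable (f n)) (n : ℤ) : Measurable (gradAvg μ f n) :=
  measurable_avg _ (hf n)

theorem measurable_gradSeq [SecondCountableTopology X] {μ : Measure X} [SFinite μ]
    (β : ℝ) (m : ℤ) {f : ℤ → X → ℝ≥0∞} (hf : ∀ n, Measurable (f n)) (n : ℤ) :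
    Measurable (gradSeq μ β m f n) := by
  refine (measurable_gradAvg hf n).add ?_
  split_ifs
  · exact (Measurable.tsum fun j => (measurable_gradAvg hf j).const_mul _).const_mul _
  · exact measurable_const

/-- The test function built from a smoothed potential. -/
def cutoffPot (μ : Measure X) (β : ℝ) (f : ℤ → X → ℝ≥0∞) (s : Finset ℤ) (x₀ : X) (r : ℝ)
    (x : X) : ℝ≥0∞ :=
  2 * bump (r⁻¹ * dist x x₀) * ∑ n ∈ s, smoothPot μ β (f n) n x

theorem cutoffPot_le_add [SecondCountableTopology X] {μ : Measure X} [SFinite μ]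
    {c : ℝ≥0∞} (h : DoublingMeasure μ c) {β ε : ℝ} (hβ0 : 0 < β) (hβ1 : β < 1) (hε : ε ≤ β)
    (hε' : ε ≤ 1 - β) {f : ℤ → X → ℝ≥0∞} (hf : ∀ n, Measurable (f n)) (s : Finset ℤ) (x₀ : X)
    {r : ℝ} (hr : 0 < r) {m : ℤ} (hm : (2 : ℝ) ^ (-m - 1) ≤ r) {k : ℤ} {x y : X}
    (hd1 : (2 : ℝ) ^ (-k - 1) ≤ dist x y) (hd2 : dist x y < (2 : ℝ) ^ (-k)) :
    cutoffPot μ β f s x₀ r x ≤ cutoffPot μ β f s x₀ r y + ENNReal.ofReal (dist x y ^ β) *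
      (8 * c ^ 3 * geoConv ε (fun n => gradSeq μ β m f n x) k) := by
  set V : X → ℝ≥0∞ := fun x => ∑ n ∈ s, smoothPot μ β (f n) n x with hV
  set T : ℝ≥0∞ := ∑' j : ℤ, 2 ^ (-β * (j : ℝ)) * gradAvg μ f j x with hT
  set D : ℝ≥0∞ := ENNReal.ofReal (dist x y ^ β) with hD
  have h1 : V x ≤ V y + 2 * c ^ 3 * D * geoConv ε (fun n => gradAvg μ f n x) k := by
    calc V x ≤ ∑ n ∈ s, (smoothPot μ β (f n) n y + 2 * c ^ 3 * D *
          (2 ^ (-ε * |(n : ℝ) - k|) * gradAvg μ f n x)) :=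
          Finset.sum_le_sum fun n _ =>
            smoothPot_le_add_dyadic h hβ0 hβ1 hε hε' (hf n) n hd1 hd2
      _ = V y + 2 * c ^ 3 * D * ∑ n ∈ s, 2 ^ (-ε * |(n : ℝ) - k|) * gradAvg μ f n x := by
          rw [Finset.sum_add_distrib, ← Finset.mul_sum]
      _ ≤ _ := by
          gcongr
          exact ENNReal.sum_le_tsum _
  have h2 : V x ≤ c ^ 3 * T := by
    calc V x ≤ ∑ n ∈ s, c ^ 3 * (2 ^ (-β * (n : ℝ)) * gradAvg μ f n x) :=
          Finset.sum_le_sum fun n _ => smoothPot_le h β (f n) n x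
      _ = c ^ 3 * ∑ n ∈ s, 2 ^ (-β * (n : ℝ)) * gradAvg μ f n x := by rw [← Finset.mul_sum]
      _ ≤ _ := by
          gcongr
          exact ENNReal.sum_le_tsum _
  have h3 := bump_inv_mul_dist_le_add_dyadic hβ0 hβ1 hε hε' hr hm x₀ hd1 hd2
  set b := bump (r⁻¹ * dist y x₀) with hb
  have hb1 : b ≤ 1 := bump_le_one _
  have h4 : geoConv ε (fun n => gradSeq μ β m f n x) k =
      geoConv ε (fun n => gradAvg μ f n x) k +
        2 ^ (-ε * |(m : ℝ) - k|) * (2 ^ (β * (m : ℝ)) * T) :=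
    geoConv_add_single ε (fun n => gradAvg μ f n x) _ m k
  rw [h4]
  set g := geoConv ε (fun n => gradAvg μ f n x) k
  set e : ℝ≥0∞ := 2 ^ (-ε * |(m : ℝ) - k|)
  set e' : ℝ≥0∞ := 2 ^ (β * (m : ℝ))
  calc cutoffPot μ β f s x₀ r x ≤ 2 * (b + 4 * D * (e * e')) * V x := by
        unfold cutoffPot; gcongr
    _ = 2 * b * V x + 8 * D * (e * e') * V x := by ring
    _ ≤ 2 * b * (V y + 2 * c ^ 3 * D * g) + 8 * D * (e * e') * (c ^ 3 * T) := by gcongr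
    _ = 2 * b * V y + (4 * b * (c ^ 3 * D * g) + 8 * D * (e * e') * (c ^ 3 * T)) := by ring
    _ ≤ 2 * b * V y + (8 * 1 * (c ^ 3 * D * g) + 8 * D * (e * e') * (c ^ 3 * T)) := by
        gcongr
        norm_num
    _ = cutoffPot μ β f s x₀ r y + D * (8 * c ^ 3 * (g + e * (e' * T))) := by
        unfold cutoffPot; ring

theorem isFracGrad_cutoffPot [SecondCountableTopology X] {μ : Measure X} [SFinite μ]
    {c : ℝ≥0∞} (h : DoublingMeasure μ c) {β ε : ℝ} (hβ0 : 0 < β) (hβ1 : β < 1) (hε : ε ≤ β)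
    (hε' : ε ≤ 1 - β) {f : ℤ → X → ℝ≥0∞} (hf : ∀ n, Measurable (f n)) (s : Finset ℤ) (x₀ : X)
    {r : ℝ} (hr : 0 < r) {m : ℤ} (hm : (2 : ℝ) ^ (-m - 1) ≤ r)
    (hfin : ∀ x, cutoffPot μ β f s x₀ r x ≠ ∞) (Ω : Set X) :
    IsFracGrad μ β Ω (fun x => (cutoffPot μ β f s x₀ r x).toReal)
      fun k x => 8 * c ^ 3 * geoConv ε (fun n => gradSeq μ β m f n x) k := by
  refine ⟨fun k => (measurable_geoConv ε (measurable_gradSeq β m hf) k).const_mul _, ∅,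
    empty_subset _, measure_empty, fun k x _ y _ hd1 hd2 =>
      ofReal_abs_toReal_sub_le (hfin x) (hfin y) ?_ ?_⟩
  · refine (cutoffPot_le_add h hβ0 hβ1 hε hε' hf s x₀ hr hm hd1 hd2).trans ?_
    gcongr
    exact le_self_add
  · rw [dist_comm x y] at *
    refine (cutoffPot_le_add h hβ0 hβ1 hε hε' hf s x₀ hr hm hd1 hd2).trans ?_
    gcongr
    exact le_add_self

theorem inv_le_mul_inv_of_le {a b k : ℝ≥0∞} (ha0 : a ≠ 0) (ha : a ≠ ∞) (hb0 : b ≠ 0)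
    (hb : b ≠ ∞) (h : a ≤ k * b) : b⁻¹ ≤ k * a⁻¹ := by
  calc b⁻¹ = a * (a⁻¹ * b⁻¹) := by rw [← mul_assoc, ENNReal.mul_inv_cancel ha0 ha, one_mul]
    _ ≤ k * b * (a⁻¹ * b⁻¹) := by gcongr
    _ = k * a⁻¹ * (b * b⁻¹) := by ring
    _ = k * a⁻¹ := by rw [ENNReal.mul_inv_cancel hb0 hb, mul_one]

theorem inv_ball_le_of_isQRD {μ : Measure X} {c : ℝ≥0∞} (h : DoublingMeasure μ c)
    {σ : ℝ} {cσ : ℝ≥0∞} (hσ : 0 ≤ σ) (hqrd : IsQRD μ σ cσ) {r : ℝ} (hr : 0 < r) {m : ℤ}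
    (hm : r < (2 : ℝ) ^ (-m)) {j : ℤ} (hj : j < m) (hvalid : validIdx X j) (x : X) :
    (μ (ball x ((2 : ℝ) ^ (-j))))⁻¹ ≤
      cσ * 2 ^ (-σ * |(j : ℝ) - m|) * (μ (ball x r))⁻¹ := by
  have hrj : r < (2 : ℝ) ^ (-j) := hm.trans_le (zpow_le_zpow_right₀ one_le_two (by lia))
  have hj' : (j : ℝ) < m := by exact_mod_cast hj
  refine inv_le_mul_inv_of_le (h.pos x r hr).ne' (h.fin x r)
    (h.pos x _ (by positivity)).ne' (h.fin x _) ((hqrd x r _ hr hrj hvalid).trans ?_)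
  refine mul_le_mul' (mul_le_mul' le_rfl ?_) le_rfl
  rw [← ofReal_two_rpow]
  refine ENNReal.ofReal_le_ofReal ?_
  have h1 : r / (2 : ℝ) ^ (-j) ≤ (2 : ℝ) ^ ((j : ℝ) - m) := by
    rw [div_le_iff₀ (by positivity), ← Real.rpow_intCast 2 (-j), ← Real.rpow_add two_pos]
    refine hm.le.trans (le_of_eq ?_)
    rw [← Real.rpow_intCast]
    congr 1
    push_cast; ring
  refine (Real.rpow_le_rpow (by positivity) h1 hσ).trans (le_of_eq ?_)
  rw [← Real.rpow_mul zero_le_two, abs_of_neg (by linarith)]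
  congr 1
  ring

theorem gradAvg_le_of_lt {μ : Measure X} {c : ℝ≥0∞} (h : DoublingMeasure μ c)
    {σ β p Λ : ℝ} {q cσ : ℝ≥0∞} (hp : 1 < p) (hq : 1 ≤ q) (hσ : 0 ≤ σ)
    (hqrd : IsQRD μ σ cσ) {M : ℕ} (hM : 2 * Λ ≤ 2 ^ M) {x₀ : X} {r : ℝ} (hr : 0 < r) {m : ℤ}
    (hm : r < (2 : ℝ) ^ (-m)) {f : ℤ → X → ℝ≥0∞} (hf : IsAdmissibleSeq f) {j : ℤ} (hj : j < m)
    {x : X} (hx : x ∈ ball x₀ (Λ * r)) :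
    2 ^ (β * (m : ℝ)) * (2 ^ (-β * (j : ℝ)) * gradAvg μ f j x) ≤
      2 ^ (-(σ / p - β) * |(j : ℝ) - m|) * ((∫⁻ x, lqNorm q (fun n => f n x) ^ p ∂μ) *
        (cσ * c ^ M * (μ (ball x₀ (Λ * r)))⁻¹)) ^ (1 / p) := by
  have hp0 : 0 < p := by linarith
  set I := ∫⁻ x, lqNorm q (fun n => f n x) ^ p ∂μ with hI
  by_cases hvalid : validIdx X j
  swap
  · have : gradAvg μ f j x = 0 := by
      simp [gradAvg, avg, setAvg, hf.2 j hvalid]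
    simp [this]
  have hj' : (j : ℝ) < m := by exact_mod_cast hj
  set A := I * (cσ * c ^ M * (μ (ball x₀ (Λ * r)))⁻¹) with hA
  have h1 : gradAvg μ f j x ^ p ≤ A * 2 ^ (-σ * |(j : ℝ) - m|) := by
    calc gradAvg μ f j x ^ p ≤ (∫⁻ y, f j y ^ p ∂μ) / μ (ball x ((2 : ℝ) ^ (2 - j))) :=
          avg_rpow_le_lintegral h (by positivity) hp.le (hf.1 j) x
      _ ≤ I * (μ (ball x ((2 : ℝ) ^ (-j))))⁻¹ := by
          rw [div_eq_mul_inv]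
          refine mul_le_mul' (lintegral_mono fun y =>
            ENNReal.rpow_le_rpow (le_lqNorm hq (fun n => f n y) j) hp0.le) ?_
          refine ENNReal.inv_le_inv' (measure_mono (ball_subset_ball ?_))
          exact zpow_le_zpow_right₀ one_le_two (by lia)
      _ ≤ I * (cσ * 2 ^ (-σ * |(j : ℝ) - m|) * (c ^ M * (μ (ball x₀ (Λ * r)))⁻¹)) := by
          refine mul_le_mul' le_rfl ((inv_ball_le_of_isQRD h hσ hqrd hr hm hj hvalid x).trans ?_)
          refine mul_le_mul' le_rfl (h.inv_ball_le hr M ?_)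
          rw [dist_comm]
          nlinarith [mem_ball.mp hx]
      _ = _ := by rw [hA]; ring
  have h2 : gradAvg μ f j x ≤ A ^ (1 / p) * 2 ^ (-(σ / p) * |(j : ℝ) - m|) := by
    have h3 := ENNReal.rpow_le_rpow h1 (show 0 ≤ 1 / p by positivity)
    rw [← ENNReal.rpow_mul, mul_one_div_cancel hp0.ne', ENNReal.rpow_one,
      ENNReal.mul_rpow_of_nonneg _ _ (by positivity), ← ENNReal.rpow_mul] at h3
    refine h3.trans (le_of_eq ?_)
    congr 2
    ring
  calc 2 ^ (β * (m : ℝ)) * (2 ^ (-β * (j : ℝ)) * gradAvg μ f j x)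
      ≤ 2 ^ (β * (m : ℝ)) * (2 ^ (-β * (j : ℝ)) *
          (A ^ (1 / p) * 2 ^ (-(σ / p) * |(j : ℝ) - m|))) := by gcongr
    _ = 2 ^ (β * (m : ℝ)) * 2 ^ (-β * (j : ℝ)) * 2 ^ (-(σ / p) * |(j : ℝ) - m|) *
          A ^ (1 / p) := by ring
    _ = _ := by
        rw [← two_rpow_add, ← two_rpow_add, abs_of_neg (by linarith)]
        congr 2
        ring

theorem tsum_gradAvg_le {μ : Measure X} {c : ℝ≥0∞} (h : DoublingMeasure μ c)
    {σ β p Λ : ℝ} {q cσ : ℝ≥0∞} (hp : 1 < p) (hq : 1 ≤ q) (hσ : 0 ≤ σ)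
    (hqrd : IsQRD μ σ cσ) {M : ℕ} (hM : 2 * Λ ≤ 2 ^ M) {x₀ : X} {r : ℝ} (hr : 0 < r) {m : ℤ}
    (hm : r < (2 : ℝ) ^ (-m)) {f : ℤ → X → ℝ≥0∞} (hf : IsAdmissibleSeq f)
    {x : X} (hx : x ∈ ball x₀ (Λ * r)) :
    2 ^ (β * (m : ℝ)) * ∑' j : ℤ, 2 ^ (-β * (j : ℝ)) * gradAvg μ f j x ≤
      geo β * lqNorm q (fun n => gradAvg μ f n x) +
      geo (σ / p - β) * ((∫⁻ x, lqNorm q (fun n => f n x) ^ p ∂μ) *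
        (cσ * c ^ M * (μ (ball x₀ (Λ * r)))⁻¹)) ^ (1 / p) := by
  rw [← ENNReal.tsum_mul_left, ← tsum_geo_left β m, ← tsum_geo_left (σ / p - β) m,
    ← ENNReal.tsum_mul_right, ← ENNReal.tsum_mul_right, ← ENNReal.tsum_add]
  refine ENNReal.tsum_le_tsum fun j => ?_
  rcases lt_or_ge j m with hj | hj
  · exact (gradAvg_le_of_lt h hp hq hσ hqrd hM hr hm hf hj hx).trans le_add_self
  · refine le_trans (le_of_eq_of_le ?_ (mul_le_mul' le_rfl
      (le_lqNorm hq (fun n => gradAvg μ f n x) j))) le_self_add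
    have hj' : (m : ℝ) ≤ j := by exact_mod_cast hj
    rw [← mul_assoc, ← two_rpow_add, abs_of_nonneg (by linarith)]
    congr 2
    ring

theorem lqNorm_gradSeq_le {μ : Measure X} {c : ℝ≥0∞} (h : DoublingMeasure μ c)
    {σ β p Λ : ℝ} {q cσ : ℝ≥0∞} (hp : 1 < p) (hq : 1 ≤ q) (hσ : 0 ≤ σ)
    (hqrd : IsQRD μ σ cσ) {M : ℕ} (hM : 2 * Λ ≤ 2 ^ M) {x₀ : X} {r : ℝ} (hr : 0 < r) {m : ℤ}
    (hm : r < (2 : ℝ) ^ (-m)) {f : ℤ → X → ℝ≥0∞} (hf : IsAdmissibleSeq f)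
    {x : X} (hx : x ∈ ball x₀ (Λ * r)) :
    lqNorm q (fun n => gradSeq μ β m f n x) ≤ 2 * (1 + geo β + geo (σ / p - β)) *
      (lqNorm q (fun n => gradAvg μ f n x) +
        ((∫⁻ x, lqNorm q (fun n => f n x) ^ p ∂μ) *
          (cσ * c ^ M * (μ (ball x₀ (Λ * r)))⁻¹)) ^ (1 / p)) := by
  have h1 := tsum_gradAvg_le (β := β) h hp hq hσ hqrd hM hr hm hf hx
  set L := lqNorm q (fun n => gradAvg μ f n x)
  set A := ((∫⁻ x, lqNorm q (fun n => f n x) ^ p ∂μ) *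
          (cσ * c ^ M * (μ (ball x₀ (Λ * r)))⁻¹)) ^ (1 / p)
  refine (lqNorm_add_le hq (fun n => gradAvg μ f n x) _).trans ?_
  rw [mul_assoc]
  refine mul_le_mul' le_rfl ?_
  calc _ ≤ L + (geo β * L + geo (σ / p - β) * A) :=
        add_le_add le_rfl ((lqNorm_single_le hq _ _).trans h1)
    _ ≤ L + (geo β * L + geo (σ / p - β) * A) + (A + geo β * A + geo (σ / p - β) * L) :=
        le_self_add
    _ = _ := by ring

theorem exists_lintegral_geoConv_gradSeq_le [SecondCountableTopology X] {μ : Measure X}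
    [SigmaFinite μ] {c : ℝ≥0∞} (h : DoublingMeasure μ c)
    {σ β p Λ ε : ℝ} {q cσ : ℝ≥0∞} (hp : 1 < p) (hq : 1 < q) (hβ0 : 0 < β)
    (hσ : β * p < σ) (hcσ : cσ ≠ ∞) (hqrd : IsQRD μ σ cσ) (hε : 0 < ε) (hΛ : 0 < Λ) :
    ∃ C : ℝ≥0∞, C ≠ ∞ ∧ ∀ (x₀ : X) (r : ℝ) (m : ℤ), 0 < r → r < (2 : ℝ) ^ (-m) →
      ∀ f : ℤ → X → ℝ≥0∞, IsAdmissibleSeq f →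
        ∫⁻ x, lqNorm q (fun n => f n x) ^ p ∂μ ≠ ∞ →
        ∫⁻ x in ball x₀ (Λ * r), lqNorm q (fun k => 8 * c ^ 3 *
          geoConv ε (fun n => gradSeq μ β m f n x) k) ^ p ∂μ ≤
        C * ∫⁻ x, lqNorm q (fun n => f n x) ^ p ∂μ := by
  have hp0 : 0 < p := by linarith
  have hσ0 : 0 ≤ σ := by nlinarith
  have hδ : 0 < σ / p - β := by rw [sub_pos, lt_div_iff₀ hp0]; exact hσ
  obtain ⟨M, hM⟩ := pow_unbounded_of_one_lt (2 * Λ) one_lt_two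
  obtain ⟨Cg, hCg, hgeo⟩ := exists_lqNorm_geoConv_le hε hq.le
  obtain ⟨Cf, hCf, hFS⟩ := exists_lintegral_lqNorm_avg_le (p := p) (q := q) h
    (R := fun n : ℤ => (2 : ℝ) ^ (2 - n)) (fun n => by positivity) hp hq
  set K : ℝ≥0∞ := 8 * c ^ 3 * (Cg * (2 * (1 + geo β + geo (σ / p - β)))) with hK
  have hKt : K ≠ ∞ := by
    have h1 : c ^ 3 ≠ ∞ := ENNReal.pow_ne_top h.ne_top
    have h2 := geo_ne_top hβ0
    have h3 := geo_ne_top hδ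
    finiteness
  refine ⟨K ^ p * 2 ^ (p - 1) * (Cf + cσ * c ^ M), ?_, fun x₀ r m hr hm f hf hI => ?_⟩
  · have h1 : K ^ p ≠ ∞ := ENNReal.rpow_ne_top_of_nonneg hp0.le hKt
    have h2 := two_rpow_ne_top (p - 1)
    have h3 : c ^ M ≠ ∞ := ENNReal.pow_ne_top h.ne_top
    finiteness
  set Ω := ball x₀ (Λ * r) with hΩ
  have hFSf := hFS f hf.1 hI
  set I := ∫⁻ x, lqNorm q (fun n => f n x) ^ p ∂μ with hIdef
  set A := I * (cσ * c ^ M * (μ Ω)⁻¹) with hA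
  have hpt : ∀ x ∈ Ω, lqNorm q (fun k => 8 * c ^ 3 *
      geoConv ε (fun n => gradSeq μ β m f n x) k) ^ p ≤
      K ^ p * 2 ^ (p - 1) * (lqNorm q (fun n => gradAvg μ f n x) ^ p + A) := by
    intro x hx
    have h1 := lqNorm_gradSeq_le (β := β) h hp hq.le hσ0 hqrd hM.le hr hm hf hx
    rw [lqNorm_const_mul hq.le]
    have h2 : 8 * c ^ 3 * lqNorm q (geoConv ε fun n => gradSeq μ β m f n x) ≤
        K * (lqNorm q (fun n => gradAvg μ f n x) + A ^ (1 / p)) := by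
      rw [hK, mul_assoc (8 * c ^ 3), mul_assoc Cg]
      exact mul_le_mul' le_rfl ((hgeo _).trans (mul_le_mul' le_rfl h1))
    refine (ENNReal.rpow_le_rpow h2 hp0.le).trans ?_
    rw [ENNReal.mul_rpow_of_nonneg _ _ hp0.le, mul_assoc]
    refine mul_le_mul' le_rfl ((ENNReal.rpow_add_le_mul_rpow_add_rpow _ _ hp.le).trans ?_)
    rw [← ENNReal.rpow_mul A, one_div_mul_cancel hp0.ne', ENNReal.rpow_one]
  have hΩ0 : μ Ω ≠ 0 := (h.pos x₀ _ (by positivity)).ne'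
  have hmeas : Measurable fun x => lqNorm q (fun n => gradAvg μ f n x) ^ p :=
    (measurable_lqNorm q (measurable_gradAvg hf.1)).pow_const p
  calc _ ≤ ∫⁻ x in Ω, K ^ p * 2 ^ (p - 1) *
        (lqNorm q (fun n => gradAvg μ f n x) ^ p + A) ∂μ :=
        setLIntegral_mono' measurableSet_ball hpt
    _ = K ^ p * 2 ^ (p - 1) *
        (∫⁻ x in Ω, lqNorm q (fun n => gradAvg μ f n x) ^ p ∂μ + A * μ Ω) := by
        rw [lintegral_const_mul _ (hmeas.add_const A), lintegral_add_left hmeas,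
          setLIntegral_const]
    _ ≤ K ^ p * 2 ^ (p - 1) * (Cf * I + cσ * c ^ M * I) := by
        refine mul_le_mul' le_rfl (add_le_add ((setLIntegral_le_lintegral _ _).trans hFSf)
          (le_of_eq ?_))
        calc A * μ Ω = cσ * c ^ M * I * ((μ Ω)⁻¹ * μ Ω) := by rw [hA]; ring
          _ = _ := by rw [ENNReal.inv_mul_cancel hΩ0 (h.fin _ _), mul_one]
    _ = _ := by ring

theorem Hpot_le_tsum_smoothPot (μ : Measure X) (β : ℝ) (f : ℤ → X → ℝ≥0∞) (x : X) :
    Hpot μ β f x ≤ ∑' n : ℤ, smoothPot μ β (f n) n x := by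
  refine ENNReal.tsum_le_tsum fun n => ?_
  split_ifs
  · refine mul_le_mul' le_rfl (lintegral_mono fun y => ?_)
    by_cases hx : x ∈ ball y ((2 : ℝ) ^ (-n))
    · have h1 : (2 : ℝ) ^ n * dist x y ≤ 1 := by
        calc (2 : ℝ) ^ n * dist x y ≤ 2 ^ n * 2 ^ (-n) := by
              gcongr; exact (mem_ball.mp hx).le
          _ = 1 := by rw [← zpow_add₀ two_ne_zero]; simp
      rw [indicator_of_mem hx, bump_eq_one h1, mul_div_assoc]
    · rw [indicator_of_notMem hx, zero_mul, ENNReal.zero_div]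
      exact bot_le
  · exact bot_le

theorem exists_finset_half_lt_sum {F : ℤ → X → ℝ≥0∞} (hF : ∀ n, Continuous (F n)) {E : Set X}
    (hE : IsCompact E) (hFE : ∀ x ∈ E, 1 ≤ ∑' n, F n x) :
    ∃ s : Finset ℤ, ∀ x ∈ E, 1 / 2 < ∑ n ∈ s, F n x := by
  refine hE.elim_directed_cover (fun s : Finset ℤ => {x | 1 / 2 < ∑ n ∈ s, F n x})
    (fun s => isOpen_lt continuous_const (continuous_finsetSum _ fun n _ => hF n))
    (fun x hx => ?_) (directed_of_isDirected_le fun s t hst x hx => ?_)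
  · have h1 : (1 / 2 : ℝ≥0∞) < ∑' n, F n x :=
      lt_of_lt_of_le (by simp) (hFE x hx)
    rw [ENNReal.tsum_eq_iSup_sum, lt_iSup_iff] at h1
    exact mem_iUnion.mpr h1
  · rw [mem_ofPred] at hx ⊢
    exact lt_of_lt_of_le hx (Finset.sum_le_sum_of_subset hst)

theorem relCap_le_lintegral_gradSeq [SecondCountableTopology X] {μ : Measure X} [SigmaFinite μ]
    {c : ℝ≥0∞} (h : DoublingMeasure μ c) {β p Λ ε : ℝ} {q : ℝ≥0∞} (hp : 1 < p) (hq : 1 ≤ q)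
    (hβ0 : 0 < β) (hβ1 : β < 1) (hε : ε ≤ β) (hε' : ε ≤ 1 - β) {x₀ : X} {r : ℝ} (hr : 0 < r)
    {m : ℤ} (hm : (2 : ℝ) ^ (-m - 1) ≤ r) {E : Set X} (hE : IsCompact E)
    (hEB : E ⊆ closure (ball x₀ r)) {f : ℤ → X → ℝ≥0∞} (hf : ∀ n, Measurable (f n))
    (hfE : ∀ x ∈ E, 1 ≤ Hpot μ β f x) (hI : ∫⁻ x, lqNorm q (fun n => f n x) ^ p ∂μ ≠ ∞) :
    relCap μ β p q E x₀ r Λ ≤ ∫⁻ x in ball x₀ (Λ * r), lqNorm q (fun k => 8 * c ^ 3 *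
      geoConv ε (fun n => gradSeq μ β m f n x) k) ^ p ∂μ := by
  have hp0 : 0 < p := by linarith
  have hA : ∀ n x, avg μ ((2 : ℝ) ^ (2 - n)) (f n) x ≠ ∞ := by
    intro n x hx
    have h1 : avg μ ((2 : ℝ) ^ (2 - n)) (f n) x ^ p ≤
        (∫⁻ y, lqNorm q (fun n => f n y) ^ p ∂μ) / μ (ball x ((2 : ℝ) ^ (2 - n))) :=
      (avg_rpow_le_lintegral h (by positivity) hp.le (hf n) x).trans
        (ENNReal.div_le_div_right (lintegral_mono fun y =>
          ENNReal.rpow_le_rpow (le_lqNorm hq (fun n => f n y) n) hp0.le) _)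
    rw [hx, ENNReal.top_rpow_of_pos hp0, top_le_iff] at h1
    exact ENNReal.div_ne_top hI (h.pos x _ (by positivity)).ne' h1
  have hSt : ∀ n x, smoothPot μ β (f n) n x ≠ ∞ := fun n x => smoothPot_ne_top h β (hA n x)
  have hSc : ∀ n, Continuous (smoothPot μ β (f n) n) := fun n => by
    have := ENNReal.continuous_ofReal.comp (continuous_smoothPot_toReal h β (hf n) n (hA n))
    exact this.congr fun x => ENNReal.ofReal_toReal (hSt n x)
  obtain ⟨s, hs⟩ := exists_finset_half_lt_sum hSc hE fun x hx =>
    (hfE x hx).trans (Hpot_le_tsum_smoothPot μ β f x)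
  have hVt : ∀ x, ∑ n ∈ s, smoothPot μ β (f n) n x ≠ ∞ := fun x =>
    ENNReal.sum_ne_top.mpr fun n _ => hSt n x
  have hbt : ∀ t, 2 * bump t ≠ ∞ := fun t => ENNReal.mul_ne_top (by simp) ENNReal.ofReal_ne_top
  have hφt : ∀ x, cutoffPot μ β f s x₀ r x ≠ ∞ := fun x => ENNReal.mul_ne_top (hbt _) (hVt x)
  have hφc : Continuous fun x => (cutoffPot μ β f s x₀ r x).toReal := by
    simp only [cutoffPot, ENNReal.toReal_mul]
    refine (continuous_const.mul ?_).mul ?_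
    · exact ENNReal.continuousOn_toReal.comp_continuous
        (continuous_bump.comp (by fun_prop)) fun x => ENNReal.ofReal_ne_top
    · exact ENNReal.continuousOn_toReal.comp_continuous
        (continuous_finsetSum _ fun n _ => hSc n) hVt
  have hφ1 : ∀ x ∈ E, 1 ≤ (cutoffPot μ β f s x₀ r x).toReal := by
    intro x hx
    rw [← ENNReal.toReal_one, ENNReal.toReal_le_toReal ENNReal.one_ne_top (hφt x)]
    have hd : dist x x₀ ≤ r := closure_ball_subset_closedBall (hEB hx)
    rw [cutoffPot, bump_eq_one (by rw [inv_mul_le_iff₀ hr]; linarith), mul_one]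
    calc (1 : ℝ≥0∞) = 2 * (1 / 2) := by
          rw [one_div, ENNReal.mul_inv_cancel two_ne_zero ENNReal.ofNat_ne_top]
      _ ≤ _ := by gcongr; exact (hs x hx).le
  have hφ0 : ∀ x ∉ ball x₀ (2 * r), (cutoffPot μ β f s x₀ r x).toReal = 0 := by
    intro x hx
    rw [mem_ball, not_lt] at hx
    rw [cutoffPot, bump_eq_zero (by rw [le_inv_mul_iff₀ hr]; linarith)]
    simp
  have hgrad := isFracGrad_cutoffPot h hβ0 hβ1 hε hε' hf s x₀ hr hm hφt (ball x₀ (Λ * r))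
  unfold relCap
  refine iInf_le_of_le ⟨_, hφc, hφ1, hφ0⟩ ?_
  rw [← mixedNorm_rpow hp0]
  refine ENNReal.rpow_le_rpow ?_ hp0.le
  exact iInf_le_of_le ⟨_, hgrad⟩ le_rfl

theorem exists_relCap_le [SecondCountableTopology X] {μ : Measure X} [SigmaFinite μ]
    {c : ℝ≥0∞} (h : DoublingMeasure μ c) {σ β p Λ : ℝ} {q cσ : ℝ≥0∞} (hp : 1 < p) (hq : 1 < q)
    (hβ0 : 0 < β) (hβ1 : β < 1) (hσ : β * p < σ) (hcσ : cσ ≠ ∞) (hqrd : IsQRD μ σ cσ)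
    (hΛ : 0 < Λ) :
    ∃ C : ℝ≥0∞, C ≠ ∞ ∧ ∀ (x₀ : X) (r : ℝ), 0 < r → ∀ E : Set X, IsCompact E →
      E ⊆ closure (ball x₀ r) → ∀ D : ℝ≥0∞, D ≠ ∞ → 1 ≤ D → C ≤ D →
        relCap μ β p q E x₀ r Λ ≤ D * CpCap μ β p q E := by
  have hp0 : 0 < p := by linarith
  obtain ⟨C, hC, hle⟩ := exists_lintegral_geoConv_gradSeq_le (ε := min β (1 - β)) h hp hq hβ0 hσ
    hcσ hqrd (lt_min hβ0 (by linarith)) hΛ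
  refine ⟨C, hC, fun x₀ r hr E hE hEB D hDt hD1 hD => ?_⟩
  obtain ⟨m, hm1, hm2⟩ := exists_dyadic_scale hr
  have hD0 : D ≠ 0 := (one_pos.trans_le hD1).ne'
  rw [← ENNReal.inv_mul_le_iff hD0 hDt]
  refine le_iInf fun ⟨f, hf, hfE⟩ => ?_
  show _ ≤ mixedNorm μ univ p q f ^ p
  rw [ENNReal.inv_mul_le_iff hD0 hDt, mixedNorm_rpow hp0, Measure.restrict_univ]
  by_cases hI : ∫⁻ x, lqNorm q (fun n => f n x) ^ p ∂μ = ∞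
  · rw [hI, ENNReal.mul_top hD0]
    exact le_top
  · exact (relCap_le_lintegral_gradSeq h hp hq.le hβ0 hβ1 (min_le_left _ _) (min_le_right _ _)
      hr hm1 hE hEB hf.1 hfE hI).trans ((hle x₀ r m hr hm2 f hf hI).trans (mul_le_mul' hD le_rfl))

theorem statement0
    (μ : Measure X) [Nontrivial X]
    (c_mu : ℝ≥0∞) (hc1 : 1 < c_mu) (hc2 : c_mu ≠ ∞) (hdbl : IsDoubling μ c_mu)
    (hpos : ∀ (x : X) (r : ℝ), 0 < r → 0 < μ (ball x r))
    (hfin : ∀ (x : X) (r : ℝ), μ (ball x r) ≠ ∞)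
    (c_R c_sigma : ℝ≥0∞) (p β σ Λ : ℝ) (q : ℝ≥0∞)
    (hp : 1 < p) (hq : 1 < q) (hβ0 : 0 < β) (hβ1 : β < 1) (hΛ : 41 ≤ Λ)
    (hcR0 : 0 < c_R) (hcR1 : c_R < 1) (hrd : IsReverseDoubling μ c_R)
    (hσ : β * p < σ) (hcσ0 : 0 < c_sigma) (hcσ1 : c_sigma ≠ ∞) (hqrd : IsQRD μ σ c_sigma) :
    ∃ C : ℝ≥0∞, 1 ≤ C ∧ C ≠ ∞ ∧
      ∀ (x : X) (r : ℝ), 0 < r →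
        ENNReal.ofReal (80 * r) < EMetric.diam (Set.univ : Set X) →
        ∀ E : Set X, IsCompact E → E ⊆ closure (ball x r) →
          C⁻¹ * CpCap μ β p q E ≤ relCap μ β p q E x r Λ ∧
          relCap μ β p q E x r Λ ≤ C * CpCap μ β p q E := by
  have h : DoublingMeasure μ c_mu := ⟨hc1.le, hc2, hdbl, hpos, hfin⟩
  have := h.sigmaFinite
  have := h.secondCountable
  obtain ⟨C₁, hC₁, h₁⟩ := exists_CpCap_le (Λ := Λ) h hcR1 hrd hp hq hβ0 hβ1 hΛ
  obtain ⟨C₂, hC₂, h₂⟩ := exists_relCap_le (Λ := Λ) h hp hq hβ0 hβ1 hσ hcσ1 hqrd (by linarith)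
  have hCt : max 1 (max C₁ C₂) ≠ ∞ := by simp [hC₁, hC₂]
  have hC1 : 1 ≤ max 1 (max C₁ C₂) := le_max_left _ _
  exact ⟨max 1 (max C₁ C₂), hC1, hCt, fun x r hr hdiam E hE hEB =>
    ⟨h₁ x r hr hdiam E hEB _ hCt hC1 ((le_max_left _ _).trans (le_max_right _ _)),
      h₂ x r hr E hE hEB _ hCt hC1 ((le_max_right _ _).trans (le_max_right _ _))⟩⟩

end TLCap

end
end

section
/- Let 1<p<∞, 0<β<1, x₀∈X, r>0 and Λ≥2. Then cap^β_{p,1}(closure(B(x₀,r)), B(x₀,2r), B(x₀,Λr)) ≤ C(c_μ,β,p,Λ)·r^{-βp}·μ(B(x₀,r)). -/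
open MeasureTheory Metric Set
open scoped ENNReal NNReal

noncomputable section

namespace TLCap

variable {X : Type*} [MetricSpace X] [MeasurableSpace X] [BorelSpace X]

lemma IsDoubling.measure_ball_two_pow_mul_le {Y : Type*} [MetricSpace Y]
    [MeasurableSpace Y] {μ : Measure Y} {c : ℝ≥0∞} (h : IsDoubling μ c) (x : Y) {r : ℝ}
    (hr : 0 < r) (n : ℕ) :
    μ (ball x (2 ^ n * r)) ≤ c ^ n * μ (ball x r) := by
  induction n with
  | zero => simp
  | succ n ih =>
    calc μ (ball x (2 ^ (n + 1) * r)) = μ (ball x (2 * (2 ^ n * r))) := by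
          rw [pow_succ', mul_assoc]
      _ ≤ c * μ (ball x (2 ^ n * r)) := h x _ (by positivity)
      _ ≤ c * (c ^ n * μ (ball x r)) := by gcongr
      _ = c ^ (n + 1) * μ (ball x r) := by rw [pow_succ', mul_assoc]

/-- The radial cutoff which is `1` on `closedBall x₀ r` and `0` outside `ball x₀ (2 * r)`. -/
def radialCutoff {Y : Type*} [MetricSpace Y] (x₀ : Y) (r : ℝ) (x : Y) : ℝ :=
  max 0 (min 1 (2 - dist x x₀ / r))

lemma continuous_radialCutoff {Y : Type*} [MetricSpace Y] (x₀ : Y) (r : ℝ) :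
    Continuous (radialCutoff x₀ r) := by
  unfold radialCutoff
  fun_prop

lemma one_le_radialCutoff {Y : Type*} [MetricSpace Y] {x₀ : Y} {r : ℝ} (hr : 0 < r) {x : Y}
    (hx : x ∈ closure (ball x₀ r)) :
    1 ≤ radialCutoff x₀ r x := by
  have h : dist x x₀ / r ≤ 1 := (div_le_one hr).2 (closure_ball_subset_closedBall hx)
  exact le_max_of_le_right (le_min le_rfl (by linarith))

lemma radialCutoff_eq_zero {Y : Type*} [MetricSpace Y] {x₀ : Y} {r : ℝ} (hr : 0 < r) {x : Y}
    (hx : x ∉ ball x₀ (2 * r)) : radialCutoff x₀ r x = 0 := by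
  have h : 2 ≤ dist x x₀ / r := (le_div_iff₀ hr).2 (by simpa using hx)
  exact max_eq_left ((min_le_right _ _).trans (by linarith))

lemma abs_radialCutoff_sub_le {Y : Type*} [MetricSpace Y] {x₀ : Y} {r : ℝ} (hr : 0 < r)
    (x y : Y) :
    |radialCutoff x₀ r x - radialCutoff x₀ r y| ≤ min 1 (dist x y / r) := by
  have hx : 0 ≤ radialCutoff x₀ r x := le_max_left _ _
  have hy : 0 ≤ radialCutoff x₀ r y := le_max_left _ _
  have hx1 : radialCutoff x₀ r x ≤ 1 := max_le zero_le_one (min_le_left _ _)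
  have hy1 : radialCutoff x₀ r y ≤ 1 := max_le zero_le_one (min_le_left _ _)
  refine le_min (abs_le.2 ⟨by linarith, by linarith⟩) ?_
  calc |radialCutoff x₀ r x - radialCutoff x₀ r y|
      ≤ |min 1 (2 - dist x x₀ / r) - min 1 (2 - dist y x₀ / r)| := by
        unfold radialCutoff
        simpa only [max_comm (0 : ℝ)] using abs_max_sub_max_le_abs _ _ (0 : ℝ)
    _ ≤ |(2 - dist x x₀ / r) - (2 - dist y x₀ / r)| := by
        simpa using abs_min_sub_min_le_max 1 (2 - dist x x₀ / r) 1 (2 - dist y x₀ / r)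
    _ = |dist x x₀ - dist y x₀| / r := by
        rw [← abs_of_pos hr, ← abs_div, abs_of_pos hr, ← abs_neg]; ring_nf
    _ ≤ dist x y / r := by gcongr; exact abs_dist_sub_le x y x₀

/-- If `s` is comparable to `2 ^ (-j)`, then `min 1 s / s ^ β` decays geometrically in `|j|`. -/
lemma min_one_le_rpow_mul_pow_natAbs {β δ s : ℝ} (hβ0 : 0 < β) (hβ1 : β < 1) (hδ : δ ≤ β)
    (hδ' : δ ≤ 1 - β) (hs : 0 < s) {j : ℤ}
    (hl : (2 : ℝ) ^ (-j - 2) ≤ s) (hu : s ≤ (2 : ℝ) ^ (-j)) :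
    min 1 s ≤ s ^ β * (4 * ((2 : ℝ) ^ (-δ)) ^ j.natAbs) := by
  have hq : ((2 : ℝ) ^ (-δ)) ^ j.natAbs = 2 ^ (-δ * |(j : ℝ)|) := by
    rw [← Real.rpow_natCast, ← Real.rpow_mul two_pos.le, Nat.cast_natAbs, Int.cast_abs]
  rw [hq, ← Real.rpow_intCast] at *
  push_cast at hl hu
  rcases le_total 0 j with hj | hj
  · have hj' : (0 : ℝ) ≤ j := by exact_mod_cast hj
    have h1 : s ^ (1 - β) ≤ 2 ^ (-δ * |(j : ℝ)|) := by
      calc s ^ (1 - β) ≤ ((2 : ℝ) ^ (-j : ℝ)) ^ (1 - β) := by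
            gcongr
        _ = 2 ^ (-j * (1 - β) : ℝ) := by rw [← Real.rpow_mul two_pos.le]
        _ ≤ _ := by
            apply Real.rpow_le_rpow_of_exponent_le one_le_two
            rw [abs_of_nonneg hj']; nlinarith
    have h2 : s = s ^ β * s ^ (1 - β) := by rw [← Real.rpow_add hs]; simp
    calc min 1 s ≤ s := min_le_right _ _
      _ = s ^ β * s ^ (1 - β) := h2
      _ ≤ _ := by
        gcongr
        have : (0 : ℝ) < 2 ^ (-δ * |(j : ℝ)|) := by positivity
        linarith
  · have hj' : (j : ℝ) ≤ 0 := by exact_mod_cast hj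
    have h1 : (2 : ℝ) ^ ((-j - 2) * β) ≤ s ^ β := by
      rw [Real.rpow_mul two_pos.le]
      gcongr
    have h4 : (4 : ℝ) = 2 ^ (2 : ℝ) := by norm_num
    have h5 : 1 ≤ (2 : ℝ) ^ ((-j - 2) * β) * (2 ^ (2 : ℝ) * 2 ^ (-δ * |(j : ℝ)|)) := by
      rw [← Real.rpow_add two_pos, ← Real.rpow_add two_pos]
      apply Real.one_le_rpow one_le_two
      rw [abs_of_nonpos hj']
      nlinarith
    calc min 1 s ≤ 1 := min_le_left _ _
      _ ≤ _ := h5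
      _ ≤ _ := by rw [h4]; gcongr

/-- The constant sequence serving as a fractional gradient of the cutoff at scale `2 ^ n ≈ r`. -/
lemma isFracGrad_radialCutoff {Y : Type*} [MetricSpace Y] [MeasurableSpace Y] (μ : Measure Y)
    {β δ r : ℝ} (hβ0 : 0 < β) (hβ1 : β < 1)
    (hδ : δ ≤ β) (hδ' : δ ≤ 1 - β) (hr : 0 < r) {n : ℤ} (hl : (2 : ℝ) ^ n ≤ r)
    (hu : r < (2 : ℝ) ^ (n + 1)) (x₀ : Y) (Ω : Set Y) :
    IsFracGrad μ β Ω (radialCutoff x₀ r) fun k _ =>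
      ENNReal.ofReal (r ^ (-β)) * ENNReal.ofReal (4 * ((2 : ℝ) ^ (-δ)) ^ (k + n).natAbs) := by
  refine ⟨fun k => measurable_const, ∅, empty_subset _, measure_empty, ?_⟩
  intro k x _ y _ hd hd'
  have hdpos : 0 < dist x y := lt_of_lt_of_le (by positivity) hd
  have key := min_one_le_rpow_mul_pow_natAbs hβ0 hβ1 hδ hδ' (s := dist x y / r) (by positivity)
    (j := k + n) ?_ ?_
  · refine le_trans ?_ (mul_le_mul_right le_self_add _)
    beta_reduce
    rw [← ENNReal.ofReal_mul (by positivity), ← ENNReal.ofReal_mul (by positivity)]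
    apply ENNReal.ofReal_le_ofReal
    refine (abs_radialCutoff_sub_le hr x y).trans (key.trans_eq ?_)
    rw [Real.div_rpow hdpos.le hr.le, Real.rpow_neg hr.le]
    ring
  · rw [le_div_iff₀ hr]
    calc (2 : ℝ) ^ (-(k + n) - 2) * r ≤ 2 ^ (-(k + n) - 2) * 2 ^ (n + 1) := by gcongr
      _ = 2 ^ (-k - 1) := by rw [← zpow_add₀ two_ne_zero]; congr 1; ring
      _ ≤ dist x y := hd
  · rw [div_le_iff₀ hr]
    calc dist x y ≤ 2 ^ (-k) := hd'.le
      _ = (2 : ℝ) ^ (-(k + n)) * 2 ^ n := by rw [← zpow_add₀ two_ne_zero]; congr 1; ring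
      _ ≤ _ := by gcongr

lemma tsum_pow_natAbs_ne_top {q : ℝ} (hq0 : 0 ≤ q) (hq1 : q < 1) (c : ℝ) :
    ∑' j : ℤ, ENNReal.ofReal (c * q ^ j.natAbs) ≠ ∞ := by
  have hs : Summable fun j : ℤ => q ^ j.natAbs := by
    apply Summable.of_nat_of_neg <;> simpa using summable_geometric_of_lt_one hq0 hq1
  exact (hs.mul_left c).tsum_ofReal_ne_top

/-- The mixed `L^p(l^1)` norm of a sequence of constant functions. -/
lemma mixedNorm_one_const_rpow {Y : Type*} [MeasurableSpace Y] (μ : Measure Y) (Ω : Set Y)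
    {p : ℝ} (hp : 0 < p) (a : ℤ → ℝ≥0∞) :
    mixedNorm μ Ω p 1 (fun k _ => a k) ^ p = (∑' k, a k) ^ p * μ Ω := by
  simp [mixedNorm, lqNorm, ← ENNReal.rpow_mul, hp.ne']

theorem statement2
    (μ : Measure X) [Nontrivial X]
    (c_mu : ℝ≥0∞) (hc1 : 1 < c_mu) (hc2 : c_mu ≠ ∞) (hdbl : IsDoubling μ c_mu)
    (hpos : ∀ (x : X) (r : ℝ), 0 < r → 0 < μ (ball x r))
    (hfin : ∀ (x : X) (r : ℝ), μ (ball x r) ≠ ∞)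
    (p β Λ : ℝ) (hp : 1 < p) (hβ0 : 0 < β) (hβ1 : β < 1) (hΛ : 2 ≤ Λ) :
    ∃ C : ℝ≥0∞, 0 < C ∧ C ≠ ∞ ∧
      ∀ (x₀ : X) (r : ℝ), 0 < r →
        relCap μ β p 1 (closure (ball x₀ r)) x₀ r Λ ≤
          C * ENNReal.ofReal (r ^ (-(β * p))) * μ (ball x₀ r) := by
  obtain ⟨N, hN⟩ := pow_unbounded_of_one_lt Λ one_lt_two
  set δ := min β (1 - β) with hδdef
  have hδ : 0 < δ := lt_min hβ0 (by linarith)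
  set S : ℝ≥0∞ := ∑' j : ℤ, ENNReal.ofReal (4 * ((2 : ℝ) ^ (-δ)) ^ j.natAbs) with hSdef
  have hS : S ≠ ∞ := tsum_pow_natAbs_ne_top (by positivity)
    (Real.rpow_lt_one_of_one_lt_of_neg one_lt_two (by linarith)) 4
  have hS0 : 0 < S := by
    refine lt_of_lt_of_le ?_ (ENNReal.le_tsum (0 : ℤ))
    simp
  have hp0 : 0 < p := by linarith
  refine ⟨S ^ p * c_mu ^ N, ?_, ?_, ?_⟩
  · exact ENNReal.mul_pos (ENNReal.rpow_pos hS0 hS).ne' (pow_ne_zero _ (by positivity))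
  · exact ENNReal.mul_ne_top (ENNReal.rpow_ne_top_of_nonneg hp0.le hS) (ENNReal.pow_ne_top hc2)
  intro x₀ r hr
  obtain ⟨n, hl, hu⟩ := exists_mem_Ico_zpow hr one_lt_two
  have hgrad := isFracGrad_radialCutoff μ hβ0 hβ1 (min_le_left _ _) (min_le_right _ _) hr hl hu
    x₀ (ball x₀ (Λ * r))
  have hsum : ∑' k : ℤ, ENNReal.ofReal (r ^ (-β)) *
      ENNReal.ofReal (4 * ((2 : ℝ) ^ (-δ)) ^ (k + n).natAbs) = ENNReal.ofReal (r ^ (-β)) * S := by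
    rw [ENNReal.tsum_mul_left, hSdef]
    congr 1
    exact (Equiv.addRight n).tsum_eq
      fun j : ℤ => ENNReal.ofReal (4 * ((2 : ℝ) ^ (-δ)) ^ j.natAbs)
  have hball : μ (ball x₀ (Λ * r)) ≤ c_mu ^ N * μ (ball x₀ r) :=
    (measure_mono (ball_subset_ball (by gcongr))).trans
      (hdbl.measure_ball_two_pow_mul_le x₀ hr N)
  calc relCap μ β p 1 (closure (ball x₀ r)) x₀ r Λ
      ≤ htlSeminorm μ β p 1 (ball x₀ (Λ * r)) (radialCutoff x₀ r) ^ p :=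
        iInf_le_of_le ⟨radialCutoff x₀ r, continuous_radialCutoff x₀ r,
          fun _ => one_le_radialCutoff hr, fun _ => radialCutoff_eq_zero hr⟩ le_rfl
    _ ≤ (mixedNorm μ (ball x₀ (Λ * r)) p 1 fun k _ => ENNReal.ofReal (r ^ (-β)) *
          ENNReal.ofReal (4 * ((2 : ℝ) ^ (-δ)) ^ (k + n).natAbs)) ^ p :=
        ENNReal.rpow_le_rpow (iInf_le_of_le ⟨_, hgrad⟩ le_rfl) hp0.le
    _ = (ENNReal.ofReal (r ^ (-β)) * S) ^ p * μ (ball x₀ (Λ * r)) := by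
        rw [mixedNorm_one_const_rpow μ _ hp0, hsum]
    _ ≤ (ENNReal.ofReal (r ^ (-β)) * S) ^ p * (c_mu ^ N * μ (ball x₀ r)) := by gcongr
    _ = S ^ p * c_mu ^ N * ENNReal.ofReal (r ^ (-(β * p))) * μ (ball x₀ r) := by
        rw [ENNReal.mul_rpow_of_nonneg _ _ hp0.le,
          ENNReal.ofReal_rpow_of_pos (by positivity), ← Real.rpow_mul hr.le, neg_mul]
        ring

end TLCap

end
end
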